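/- arXiv:2106.06798 — 6 statements merged into one kernel-verified Lean document; each statement's English description precedes it below -/
import Mathlib

section
/- Let 0 < α < 1 and 0 < δ < 1-α. For k > 0 define F(k) = ∫₀^∞ (1-y^{-δ})/(k+|1-y|²)^{(1+α)/2} dy. Then F(k) is uniformly bounded in k > 0, the limit lim_{k→0} F(k) exists and equals F(0) = ∫₀^∞ (1-y^{-δ})/|1-y|^{1+α} dy, and F(0) > 0. -/
open MeasureTheory Set Filter

theorem integrableOn_rpow_mul_one_sub_rpow {a b : ℝ} (ha : -1 < a) (hb : -1 < b) :
    IntegrableOn (fun x : ℝ => x ^ a * (1 - x) ^ b) (Ioo 0 1) := by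
  have h := Complex.betaIntegral_convergent (u := ((a + 1 : ℝ) : ℂ)) (v := ((b + 1 : ℝ) : ℂ))
    (by rw [Complex.ofReal_re]; linarith) (by rw [Complex.ofReal_re]; linarith)
  rw [intervalIntegrable_iff_integrableOn_Ioo_of_le zero_le_one] at h
  refine (IntegrableOn.congr_fun h.norm (fun x hx => ?_) measurableSet_Ioo)
  have h1 : (0 : ℝ) < 1 - x := sub_pos.2 hx.2
  have h2 : (1 - (x : ℂ)) = ((1 - x : ℝ) : ℂ) := by push_cast; rfl
  simp only [norm_mul]
  rw [h2, Complex.norm_cpow_eq_rpow_re_of_pos hx.1, Complex.norm_cpow_eq_rpow_re_of_pos h1]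
  simp

theorem image_inv_Ioo_zero_one : (fun x : ℝ => x⁻¹) '' Ioo 0 1 = Ioi 1 := by
  have h := Set.inv_Ioo_0_left (one_pos (α := ℝ))
  rw [inv_one] at h
  rw [← h, ← Set.image_inv_eq_inv]

theorem hasDerivWithinAt_inv_Ioo (x : ℝ) (hx : x ∈ Ioo (0 : ℝ) 1) :
    HasDerivWithinAt (fun x : ℝ => x⁻¹) (-(x ^ 2)⁻¹) (Ioo 0 1) x :=
  (hasDerivAt_inv hx.1.ne').hasDerivWithinAt

theorem integrableOn_Ioi_one_iff_comp_inv (g : ℝ → ℝ) :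
    IntegrableOn g (Ioi 1) ↔ IntegrableOn (fun x => |-(x ^ 2)⁻¹| • g x⁻¹) (Ioo 0 1) := by
  rw [← image_inv_Ioo_zero_one]
  exact integrableOn_image_iff_integrableOn_abs_deriv_smul measurableSet_Ioo
    hasDerivWithinAt_inv_Ioo inv_injective.injOn g

theorem integral_Ioi_one_eq_comp_inv (g : ℝ → ℝ) :
    ∫ y in Ioi 1, g y = ∫ x in Ioo 0 1, |-(x ^ 2)⁻¹| • g x⁻¹ := by
  rw [← image_inv_Ioo_zero_one]
  exact integral_image_eq_integral_abs_deriv_smul measurableSet_Ioo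
    hasDerivWithinAt_inv_Ioo inv_injective.injOn g

theorem kernel_comp_inv {α δ x : ℝ} (hx : x ∈ Ioo (0 : ℝ) 1) :
    |-(x ^ 2)⁻¹| • ((1 - x⁻¹ ^ (-δ)) / |1 - x⁻¹| ^ (1 + α)) =
      (1 - x ^ δ) * x ^ (α - 1) / (1 - x) ^ (1 + α) := by
  obtain ⟨h0, h1⟩ := hx
  have h1' : 0 < 1 - x := sub_pos.2 h1
  have habs : |1 - x⁻¹| = (1 - x) / x := by
    rw [show 1 - x⁻¹ = -((1 - x) / x) by field_simp; ring, abs_neg, abs_of_pos (by positivity)]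
  have hpow : x ^ (α - 1) = x ^ (1 + α) / x ^ 2 := by
    rw [← Real.rpow_natCast, ← Real.rpow_sub h0]; congr 1; push_cast; ring
  have hp : 0 < x ^ (1 + α) := Real.rpow_pos_of_pos h0 _
  have hq : 0 < (1 - x) ^ (1 + α) := Real.rpow_pos_of_pos h1' _
  rw [abs_neg, abs_of_pos (by positivity), habs, Real.div_rpow h1'.le h0.le,
    Real.inv_rpow h0.le, Real.rpow_neg h0.le, inv_inv, hpow, smul_eq_mul]
  field_simp

theorem one_sub_rpow_div_le {α δ x : ℝ} (hδ : 0 < δ) (hδ1 : δ ≤ 1) (hx : x ∈ Ioo (0 : ℝ) 1) :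
    0 ≤ 1 - x ^ δ ∧ (1 - x ^ δ) / (1 - x) ^ (1 + α) ≤ (1 - x) ^ (-α) := by
  obtain ⟨h0, h1⟩ := hx
  have h1' : 0 < 1 - x := sub_pos.2 h1
  refine ⟨sub_nonneg.2 (Real.rpow_le_one h0.le h1.le hδ.le), ?_⟩
  have h2 := Real.self_le_rpow_of_le_one h0.le h1.le hδ1
  rw [div_le_iff₀ (Real.rpow_pos_of_pos h1' _), ← Real.rpow_add h1']
  rw [show -α + (1 + α) = 1 by ring, Real.rpow_one]
  linarith

theorem measurable_kernel (α δ : ℝ) :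
    Measurable (fun y : ℝ => (1 - y ^ (-δ)) / |1 - y| ^ (1 + α)) := by fun_prop

theorem integrableOn_kernel_Ioo {α δ : ℝ} (hα1 : α < 1) (hδ0 : 0 < δ) (hδ1 : δ < 1) :
    IntegrableOn (fun y : ℝ => (1 - y ^ (-δ)) / |1 - y| ^ (1 + α)) (Ioo 0 1) := by
  refine Integrable.mono' (integrableOn_rpow_mul_one_sub_rpow (a := -δ) (b := -α)
    (by linarith) (by linarith)) (measurable_kernel α δ).aestronglyMeasurable ?_
  refine (ae_restrict_iff' measurableSet_Ioo).2 (ae_of_all _ fun x hx => ?_)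
  obtain ⟨hn, hle⟩ := one_sub_rpow_div_le (α := α) hδ0 hδ1.le hx
  have h1' : 0 < 1 - x := sub_pos.2 hx.2
  have hp : 0 < x ^ δ := Real.rpow_pos_of_pos hx.1 _
  have hq : 0 < (1 - x) ^ (1 + α) := Real.rpow_pos_of_pos h1' _
  have heq : (1 - x ^ (-δ)) / |1 - x| ^ (1 + α) =
      -(x ^ (-δ) * ((1 - x ^ δ) / (1 - x) ^ (1 + α))) := by
    rw [abs_of_pos h1', Real.rpow_neg hx.1.le]
    field_simp
    ring
  rw [heq, norm_neg, Real.norm_of_nonneg (by have := Real.rpow_nonneg hx.1.le (-δ); positivity)]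
  exact mul_le_mul_of_nonneg_left hle (Real.rpow_nonneg hx.1.le _)

theorem integrableOn_kernel_Ioi_one {α δ : ℝ} (hα0 : 0 < α) (hα1 : α < 1) (hδ0 : 0 < δ)
    (hδ1 : δ < 1) :
    IntegrableOn (fun y : ℝ => (1 - y ^ (-δ)) / |1 - y| ^ (1 + α)) (Ioi 1) := by
  rw [integrableOn_Ioi_one_iff_comp_inv]
  refine IntegrableOn.congr_fun (f := fun x : ℝ => (1 - x ^ δ) * x ^ (α - 1) / (1 - x) ^ (1 + α))
    ?_ (fun x hx => (kernel_comp_inv hx).symm) measurableSet_Ioo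
  refine Integrable.mono' (integrableOn_rpow_mul_one_sub_rpow (a := α - 1) (b := -α)
    (by linarith) (by linarith)) (Measurable.aestronglyMeasurable (by fun_prop)) ?_
  refine (ae_restrict_iff' measurableSet_Ioo).2 (ae_of_all _ fun x hx => ?_)
  obtain ⟨hn, hle⟩ := one_sub_rpow_div_le (α := α) hδ0 hδ1.le hx
  have hp : 0 ≤ x ^ (α - 1) := Real.rpow_nonneg hx.1.le _
  have hq : 0 < (1 - x) ^ (1 + α) := Real.rpow_pos_of_pos (sub_pos.2 hx.2) _
  rw [Real.norm_of_nonneg (by positivity), mul_comm, mul_div_assoc]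
  exact mul_le_mul_of_nonneg_left hle hp

theorem Ioi_zero_eq_Ioc_union_Ioi : Ioi (0 : ℝ) = Ioc 0 1 ∪ Ioi 1 :=
  (Ioc_union_Ioi_eq_Ioi zero_le_one).symm

theorem integrableOn_kernel {α δ : ℝ} (hα0 : 0 < α) (hα1 : α < 1) (hδ0 : 0 < δ) (hδ1 : δ < 1) :
    IntegrableOn (fun y : ℝ => (1 - y ^ (-δ)) / |1 - y| ^ (1 + α)) (Ioi 0) := by
  rw [Ioi_zero_eq_Ioc_union_Ioi, integrableOn_union, integrableOn_Ioc_iff_integrableOn_Ioo]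
  exact ⟨integrableOn_kernel_Ioo hα1 hδ0 hδ1, integrableOn_kernel_Ioi_one hα0 hα1 hδ0 hδ1⟩

theorem folded_kernel_pos {α δ x : ℝ} (hδ0 : 0 < δ) (hδ1 : δ < 1 - α)
    (hx : x ∈ Ioo (0 : ℝ) 1) :
    0 < (1 - x ^ (-δ)) / |1 - x| ^ (1 + α) +
      |-(x ^ 2)⁻¹| • ((1 - x⁻¹ ^ (-δ)) / |1 - x⁻¹| ^ (1 + α)) := by
  rw [kernel_comp_inv hx]
  obtain ⟨h0, h1⟩ := hx
  have h1' : 0 < 1 - x := sub_pos.2 h1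
  rw [abs_of_pos h1', ← add_div]
  refine div_pos ?_ (Real.rpow_pos_of_pos h1' _)
  have ha := Real.one_lt_rpow_of_pos_of_lt_one_of_neg h0 h1 (z := -δ) (by linarith)
  have hb := Real.one_lt_rpow_of_pos_of_lt_one_of_neg h0 h1 (z := δ + (α - 1)) (by linarith)
  have hc : x ^ (-δ) * x ^ (δ + (α - 1)) = x ^ (α - 1) := by
    rw [← Real.rpow_add h0]; congr 1; ring
  have hd : x ^ (δ + (α - 1)) = x ^ δ * x ^ (α - 1) := Real.rpow_add h0 _ _
  have hfac := mul_pos (sub_pos.2 ha) (sub_pos.2 hb)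
  linarith

theorem integral_kernel_pos {α δ : ℝ} (hα0 : 0 < α) (hα1 : α < 1) (hδ0 : 0 < δ)
    (hδ1 : δ < 1 - α) :
    0 < ∫ y in Ioi (0:ℝ), (1 - y ^ (-δ)) / |1 - y| ^ (1 + α) := by
  have hI := integrableOn_kernel_Ioo hα1 hδ0 (hδ1.trans (by linarith))
  have hJ := integrableOn_kernel_Ioi_one hα0 hα1 hδ0 (hδ1.trans (by linarith))
  rw [Ioi_zero_eq_Ioc_union_Ioi, setIntegral_union (Ioc_disjoint_Ioi le_rfl) measurableSet_Ioi
    (integrableOn_Ioc_iff_integrableOn_Ioo (by simp) |>.2 hI) hJ, integral_Ioc_eq_integral_Ioo,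
    integral_Ioi_one_eq_comp_inv, ← integral_add hI ((integrableOn_Ioi_one_iff_comp_inv _).1 hJ)]
  have hpos := fun x (hx : x ∈ Ioo (0 : ℝ) 1) => folded_kernel_pos hδ0 hδ1 hx
  rw [setIntegral_pos_iff_support_of_nonneg_ae
    ((ae_restrict_iff' measurableSet_Ioo).2 (ae_of_all _ fun x hx => (hpos x hx).le))
    (hI.add ((integrableOn_Ioi_one_iff_comp_inv _).1 hJ))]
  rw [inter_eq_right.2 fun x hx => Function.mem_support.2 (hpos x hx).ne']
  simp

theorem sq_rpow_half (α y : ℝ) : (|1 - y| ^ 2) ^ ((1 + α) / 2) = |1 - y| ^ (1 + α) := by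
  rw [← Real.rpow_natCast, ← Real.rpow_mul (abs_nonneg _)]
  congr 1
  push_cast
  ring

theorem norm_regularized_kernel_le {α k : ℝ} (δ : ℝ) (hα0 : 0 < α) (hk : 0 < k) (y : ℝ) :
    ‖(1 - y ^ (-δ)) / (k + |1 - y| ^ 2) ^ ((1 + α) / 2)‖ ≤
      ‖(1 - y ^ (-δ)) / |1 - y| ^ (1 + α)‖ := by
  rcases eq_or_ne y 1 with rfl | hy
  · simp
  have h : 0 < |1 - y| := abs_pos.2 (sub_ne_zero.2 hy.symm)
  have hnum := norm_nonneg (1 - y ^ (-δ))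
  rw [← sq_rpow_half, norm_div, norm_div,
    Real.norm_of_nonneg (r := (k + |1 - y| ^ 2) ^ ((1 + α) / 2)) (by positivity),
    Real.norm_of_nonneg (r := (|1 - y| ^ 2) ^ ((1 + α) / 2)) (by positivity)]
  gcongr
  linarith

theorem tendsto_regularized_kernel {α : ℝ} (δ y : ℝ) (hα0 : 0 < α) :
    Tendsto (fun k : ℝ => (1 - y ^ (-δ)) / (k + |1 - y| ^ 2) ^ ((1 + α) / 2))
      (nhdsWithin 0 (Ioi 0)) (nhds ((1 - y ^ (-δ)) / |1 - y| ^ (1 + α))) := by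
  rcases eq_or_ne y 1 with rfl | hy
  · simp
  have h : 0 < |1 - y| := abs_pos.2 (sub_ne_zero.2 hy.symm)
  have hc : ContinuousAt (fun k : ℝ => (1 - y ^ (-δ)) / (k + |1 - y| ^ 2) ^ ((1 + α) / 2)) 0 := by
    refine continuousAt_const.div (ContinuousAt.rpow_const (by fun_prop) (Or.inr (by positivity)))
      ?_
    rw [zero_add, sq_rpow_half]
    positivity
  have ht := hc.tendsto.mono_left (nhdsWithin_le_nhds (s := Ioi 0))
  rwa [zero_add, sq_rpow_half] at ht

/-- for 0 < α < 1 and 0 < δ < 1-α, the function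
F(k) = ∫₀^∞ (1-y^{-δ})/(k+|1-y|²)^{(1+α)/2} dy is well defined and uniformly bounded
for k > 0, F(k) → F(0) as k → 0⁺, where F(0) = ∫₀^∞ (1-y^{-δ})/|1-y|^{1+α} dy > 0. -/
theorem stmt_1 (α δ : ℝ) (hα0 : 0 < α) (hα1 : α < 1) (hδ0 : 0 < δ) (hδ1 : δ < 1 - α) :
    (∀ k : ℝ, 0 < k →
      IntegrableOn (fun y : ℝ => (1 - y ^ (-δ)) / (k + |1 - y| ^ 2) ^ ((1 + α) / 2))
        (Ioi 0)) ∧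
    IntegrableOn (fun y : ℝ => (1 - y ^ (-δ)) / |1 - y| ^ (1 + α)) (Ioi (0:ℝ)) ∧
    (∃ M : ℝ, ∀ k : ℝ, 0 < k →
      |∫ y in Ioi (0:ℝ), (1 - y ^ (-δ)) / (k + |1 - y| ^ 2) ^ ((1 + α) / 2)| ≤ M) ∧
    Tendsto (fun k : ℝ => ∫ y in Ioi (0:ℝ), (1 - y ^ (-δ)) / (k + |1 - y| ^ 2) ^ ((1 + α) / 2))
      (nhdsWithin 0 (Ioi 0))
      (nhds (∫ y in Ioi (0:ℝ), (1 - y ^ (-δ)) / |1 - y| ^ (1 + α))) ∧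
    0 < ∫ y in Ioi (0:ℝ), (1 - y ^ (-δ)) / |1 - y| ^ (1 + α) := by
  have hg := integrableOn_kernel hα0 hα1 hδ0 (hδ1.trans (by linarith))
  have hmeas : ∀ k : ℝ, Measurable
      (fun y : ℝ => (1 - y ^ (-δ)) / (k + |1 - y| ^ 2) ^ ((1 + α) / 2)) := fun k => by fun_prop
  refine ⟨fun k hk => ?_, hg, ⟨∫ y in Ioi (0:ℝ), ‖(1 - y ^ (-δ)) / |1 - y| ^ (1 + α)‖,
    fun k hk => ?_⟩, ?_, integral_kernel_pos hα0 hα1 hδ0 hδ1⟩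
  · exact Integrable.mono hg (hmeas k).aestronglyMeasurable
      (ae_of_all _ (norm_regularized_kernel_le δ hα0 hk))
  · exact norm_integral_le_of_norm_le hg.norm
      (ae_of_all _ (norm_regularized_kernel_le δ hα0 hk))
  · refine tendsto_integral_filter_of_dominated_convergence _
      (Eventually.of_forall fun k => (hmeas k).aestronglyMeasurable) ?_ hg.norm
      (ae_of_all _ fun y => tendsto_regularized_kernel δ y hα0)
    filter_upwards [self_mem_nhdsWithin] with k hk
    exact ae_of_all _ (norm_regularized_kernel_le δ hα0 hk)
end

section
/- Let 0 < α < 1 and 0 < δ < 1-α, and set w(x) = x^{-δ} for x > 0. Then sup over x > 0 and ε > 0 of (x^α/w(x))·|∫₀^∞ (w(x)-w(y))/(ε²+|x-y|²)^{(1+α)/2} dy| is finite, bounded by a constant depending only on α and δ. -/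
open MeasureTheory Set

lemma abs_one_sub_rpow_neg_le {δ t : ℝ} (hδ0 : 0 < δ) (hδ1 : δ < 1) (ht : 1 / 2 ≤ t) :
    |1 - t ^ (-δ)| ≤ 2 * |1 - t| := by
  have ht0 : 0 < t := by linarith
  have hinv : t * t⁻¹ = 1 := mul_inv_cancel₀ ht0.ne'
  have hi0 : 0 < t⁻¹ := inv_pos.mpr ht0
  rcases le_total t 1 with h | h
  · have h1 : t ^ (-δ) ≤ t⁻¹ := by
      rw [← Real.rpow_neg_one]
      exact Real.rpow_le_rpow_of_exponent_ge ht0 h (by linarith)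
    have h2 : 1 ≤ t ^ (-δ) := Real.one_le_rpow_of_pos_of_le_one_of_nonpos ht0 h (by linarith)
    have h3 : t⁻¹ ≤ 2 := by
      rw [inv_le_comm₀ ht0 (by norm_num)]; linarith
    rw [abs_of_nonpos (by linarith), abs_of_nonneg (by linarith)]
    nlinarith
  · have h1 : t⁻¹ ≤ t ^ (-δ) := by
      rw [← Real.rpow_neg_one]
      exact Real.rpow_le_rpow_of_exponent_le h (by linarith)
    have h2 : t ^ (-δ) ≤ 1 := Real.rpow_le_one_of_one_le_of_nonpos h (by linarith)
    rw [abs_of_nonneg (by linarith), abs_of_nonpos (by linarith)]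
    nlinarith

lemma abs_one_sub_rpow_neg_mul_le {α δ t : ℝ} (hα0 : 0 < α) (hδ0 : 0 < δ) (hδ1 : δ < 1)
    (ht : 1 / 2 ≤ t) :
    |1 - t ^ (-δ)| * |1 - t| ^ (-1 - α) ≤ 2 * |1 - t| ^ (-α) := by
  rcases (abs_nonneg (1 - t)).eq_or_lt with h | h
  · rw [← h, Real.zero_rpow (by linarith : (-1 - α) ≠ 0), mul_zero]
    positivity
  · calc _ ≤ 2 * |1 - t| * |1 - t| ^ (-1 - α) := by
          gcongr
          exact abs_one_sub_rpow_neg_le hδ0 hδ1 ht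
      _ = 2 * |1 - t| ^ (-α) := by
          rw [mul_assoc, ← Real.rpow_one_add' h.le (by linarith)]
          congr 2
          ring

lemma integrableOn_abs_one_sub_rpow_neg_mul {α δ : ℝ} (hα0 : 0 < α) (hα1 : α < 1) (hδ0 : 0 < δ)
    (hδ1 : δ < 1) :
    IntegrableOn (fun t : ℝ => |1 - t ^ (-δ)| * |1 - t| ^ (-1 - α)) (Ioi 0) := by
  have hm : Measurable (fun t : ℝ => |1 - t ^ (-δ)| * |1 - t| ^ (-1 - α)) := by fun_prop
  have hnorm : ∀ t : ℝ, ‖|1 - t ^ (-δ)| * |1 - t| ^ (-1 - α)‖ =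
      |1 - t ^ (-δ)| * |1 - t| ^ (-1 - α) := fun t => Real.norm_of_nonneg (by positivity)
  have h1 : IntegrableOn (fun t : ℝ => |1 - t ^ (-δ)| * |1 - t| ^ (-1 - α)) (Ioc 0 (1 / 2)) := by
    have hi : IntegrableOn (fun t : ℝ => t ^ (-δ) * (1 / 2 : ℝ) ^ (-1 - α)) (Ioc 0 (1 / 2)) := by
      rw [← intervalIntegrable_iff_integrableOn_Ioc_of_le (by norm_num)]
      exact (intervalIntegral.intervalIntegrable_rpow' (by linarith)).mul_const _
    refine Integrable.mono' hi hm.aestronglyMeasurable ?_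
    refine (ae_restrict_iff' measurableSet_Ioc).mpr (.of_forall fun t ht => ?_)
    rw [hnorm]
    have h2 : 1 ≤ t ^ (-δ) :=
      Real.one_le_rpow_of_pos_of_le_one_of_nonpos ht.1 (by linarith [ht.2]) (by linarith)
    have h3 : |1 - t| ^ (-1 - α) ≤ (1 / 2 : ℝ) ^ (-1 - α) := by
      rw [abs_of_nonneg (by linarith [ht.2])]
      exact Real.rpow_le_rpow_of_nonpos (by norm_num) (by linarith [ht.2]) (by linarith)
    have h4 : |1 - t ^ (-δ)| ≤ t ^ (-δ) := by
      rw [abs_of_nonpos (by linarith)]; linarith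
    gcongr
  have h2 : IntegrableOn (fun t : ℝ => |1 - t ^ (-δ)| * |1 - t| ^ (-1 - α)) (Ioc (1 / 2) 1) := by
    have hi : IntegrableOn (fun t : ℝ => 2 * (1 - t) ^ (-α)) (Ioc (1 / 2) 1) := by
      rw [← intervalIntegrable_iff_integrableOn_Ioc_of_le (by norm_num)]
      have := (intervalIntegral.intervalIntegrable_rpow' (a := 1 / 2) (b := 0) (r := -α)
        (by linarith)).comp_sub_left 1
      norm_num at this
      exact (by simpa using this : IntervalIntegrable _ _ (1 / 2) 1).const_mul 2
    refine Integrable.mono' hi hm.aestronglyMeasurable ?_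
    refine (ae_restrict_iff' measurableSet_Ioc).mpr (.of_forall fun t ht => ?_)
    rw [hnorm]
    have := abs_one_sub_rpow_neg_mul_le hα0 hδ0 hδ1 ht.1.le
    rwa [abs_of_nonneg (by linarith [ht.2] : 0 ≤ 1 - t)] at this ⊢
  have h3 : IntegrableOn (fun t : ℝ => |1 - t ^ (-δ)| * |1 - t| ^ (-1 - α)) (Ioc 1 2) := by
    have hi : IntegrableOn (fun t : ℝ => 2 * (t - 1) ^ (-α)) (Ioc 1 2) := by
      rw [← intervalIntegrable_iff_integrableOn_Ioc_of_le (by norm_num)]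
      have := (intervalIntegral.intervalIntegrable_rpow' (a := 0) (b := 1) (r := -α)
        (by linarith)).comp_sub_right 1
      norm_num at this
      exact this.const_mul 2
    refine Integrable.mono' hi hm.aestronglyMeasurable ?_
    refine (ae_restrict_iff' measurableSet_Ioc).mpr (.of_forall fun t ht => ?_)
    rw [hnorm]
    have := abs_one_sub_rpow_neg_mul_le hα0 hδ0 hδ1 (by linarith [ht.1] : 1 / 2 ≤ t)
    rwa [abs_sub_comm 1 t, abs_of_nonneg (by linarith [ht.1] : 0 ≤ t - 1)] at this ⊢
  have h4 : IntegrableOn (fun t : ℝ => |1 - t ^ (-δ)| * |1 - t| ^ (-1 - α)) (Ioi 2) := by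
    have hi : IntegrableOn (fun t : ℝ => t ^ (-1 - α) * (1 / 2 : ℝ) ^ (-1 - α)) (Ioi 2) :=
      (integrableOn_Ioi_rpow_of_lt (by linarith) (by norm_num)).mul_const _
    refine Integrable.mono' hi hm.aestronglyMeasurable ?_
    refine (ae_restrict_iff' measurableSet_Ioi).mpr (.of_forall fun t ht => ?_)
    have ht : 2 < t := ht
    rw [hnorm]
    have h2 : t ^ (-δ) ≤ 1 := Real.rpow_le_one_of_one_le_of_nonpos (by linarith) (by linarith)
    have h0 : 0 ≤ t ^ (-δ) := Real.rpow_nonneg (by linarith) _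
    have h3 : |1 - t| ^ (-1 - α) ≤ t ^ (-1 - α) * (1 / 2 : ℝ) ^ (-1 - α) := by
      rw [← Real.mul_rpow (by linarith) (by norm_num), abs_of_nonpos (by linarith)]
      exact Real.rpow_le_rpow_of_nonpos (by linarith) (by linarith) (by linarith)
    have h4 : |1 - t ^ (-δ)| ≤ 1 := by
      rw [abs_of_nonneg (by linarith)]; linarith
    exact (mul_le_of_le_one_left (by positivity) h4).trans h3
  have h := ((h1.union h2).union h3).union h4
  rwa [Ioc_union_Ioc_eq_Ioc (by norm_num) (by norm_num),
    Ioc_union_Ioc_eq_Ioc (by norm_num) (by norm_num), Ioc_union_Ioi_eq_Ioi (by norm_num)] at h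

lemma norm_rpow_neg_sub_div_le {α δ x y : ℝ} (ε : ℝ) (hα0 : 0 < α) (hx : 0 < x) (hy : 0 < y) :
    ‖(x ^ (-δ) - y ^ (-δ)) / (ε ^ 2 + |x - y| ^ 2) ^ ((1 + α) / 2)‖ ≤
      x ^ (-δ) * x ^ (-1 - α) * (|1 - (x⁻¹ * y) ^ (-δ)| * |1 - x⁻¹ * y| ^ (-1 - α)) := by
  rcases eq_or_ne x y with rfl | hxy
  · simp [hx.ne']
  have hd : 0 < |x - y| := abs_pos.mpr (sub_ne_zero.mpr hxy)
  have e : x * (x⁻¹ * y) = y := by field_simp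
  have e1 : x ^ (-δ) * |1 - (x⁻¹ * y) ^ (-δ)| = |x ^ (-δ) - y ^ (-δ)| := by
    rw [← abs_of_pos (Real.rpow_pos_of_pos hx (-δ)), ← abs_mul, mul_sub, mul_one,
      abs_of_pos (Real.rpow_pos_of_pos hx (-δ)), ← Real.mul_rpow hx.le (by positivity), e]
  have e2 : x ^ (-1 - α) * |1 - x⁻¹ * y| ^ (-1 - α) = |x - y| ^ (-1 - α) := by
    rw [← Real.mul_rpow hx.le (abs_nonneg _)]
    congr 1
    nth_rw 1 [← abs_of_pos hx]
    rw [← abs_mul, mul_sub, mul_one, e]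
  have e3 : |x - y| ^ (-1 - α) = (|x - y| ^ (1 + α))⁻¹ := by
    rw [← Real.rpow_neg hd.le]; congr 1; ring
  have e4 : |x - y| ^ (1 + α) ≤ (ε ^ 2 + |x - y| ^ 2) ^ ((1 + α) / 2) := by
    calc |x - y| ^ (1 + α) = (|x - y| ^ 2) ^ ((1 + α) / 2) := by
          rw [← Real.rpow_natCast_mul hd.le]; congr 1; push_cast; ring
      _ ≤ _ := by
          apply Real.rpow_le_rpow (by positivity) _ (by positivity)
          nlinarith [sq_nonneg ε]
  rw [mul_mul_mul_comm, e1, e2, e3, norm_div, Real.norm_eq_abs, Real.norm_of_nonneg (by positivity),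
    div_eq_mul_inv]
  gcongr

/-- with w(x) = x^{-δ}, the quantity
(x^α/w(x))·|∫₀^∞ (w(x)-w(y))/(ε²+|x-y|²)^{(1+α)/2} dy| is bounded uniformly in
x > 0 and ε > 0, by a constant depending only on α and δ. -/
theorem stmt_3 (α δ : ℝ) (hα0 : 0 < α) (hα1 : α < 1) (hδ0 : 0 < δ) (hδ1 : δ < 1 - α) :
    ∃ C : ℝ, ∀ x ε : ℝ, 0 < x → 0 < ε →
      IntegrableOn
        (fun y : ℝ => (x ^ (-δ) - y ^ (-δ)) / (ε ^ 2 + |x - y| ^ 2) ^ ((1 + α) / 2))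
        (Ioi 0) ∧
      x ^ α / x ^ (-δ) *
        |∫ y in Ioi (0:ℝ), (x ^ (-δ) - y ^ (-δ)) / (ε ^ 2 + |x - y| ^ 2) ^ ((1 + α) / 2)|
        ≤ C := by
  set g : ℝ → ℝ := fun t => |1 - t ^ (-δ)| * |1 - t| ^ (-1 - α)
  refine ⟨∫ t in Ioi (0 : ℝ), g t, fun x ε hx _ => ?_⟩
  have hgi : IntegrableOn g (Ioi 0) :=
    integrableOn_abs_one_sub_rpow_neg_mul hα0 hα1 hδ0 (by linarith)
  have hi : IntegrableOn (fun y => x ^ (-δ) * x ^ (-1 - α) * g (x⁻¹ * y)) (Ioi 0) := by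
    refine Integrable.const_mul ?_ _
    refine (integrableOn_Ioi_comp_mul_left_iff g 0 (inv_pos.mpr hx)).mpr ?_
    rwa [mul_zero]
  have hle : ∀ᵐ y ∂volume.restrict (Ioi (0 : ℝ)),
      ‖(x ^ (-δ) - y ^ (-δ)) / (ε ^ 2 + |x - y| ^ 2) ^ ((1 + α) / 2)‖ ≤
        x ^ (-δ) * x ^ (-1 - α) * g (x⁻¹ * y) :=
    (ae_restrict_iff' measurableSet_Ioi).mpr
      (.of_forall fun y hy => norm_rpow_neg_sub_div_le ε hα0 hx hy)
  refine ⟨Integrable.mono' hi (Measurable.aestronglyMeasurable (by fun_prop)) hle, ?_⟩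
  have hb := norm_integral_le_of_norm_le hi hle
  rw [integral_const_mul, integral_comp_mul_left_Ioi g 0 (inv_pos.mpr hx), mul_zero, inv_inv,
    smul_eq_mul, Real.norm_eq_abs] at hb
  refine (mul_le_mul_of_nonneg_left hb (by positivity)).trans_eq ?_
  have h1 : x ^ α * x ^ (-1 - α) * x = 1 := by
    rw [← Real.rpow_add hx, add_sub_cancel, Real.rpow_neg_one, inv_mul_cancel₀ hx.ne']
  have h2 : x ^ (-δ) ≠ 0 := (Real.rpow_pos_of_pos hx _).ne'
  rw [div_mul_eq_mul_div, div_eq_iff h2]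
  linear_combination (x ^ (-δ) * ∫ t in Ioi (0 : ℝ), g t) * h1
end

section
/- Let 0 < α < 1. Assume u : [0,∞) → ℝ is bounded and satisfies |u(x)| ≤ C x^{-2} for x ≥ 1 and some C > 0. Then ∫₀^∞∫₀^∞ (u(x)-u(y))²/|x-y|^{1+α} dx dy ≥ c ∫₀^∞ u(x)²/x^α dx, where c > 0 depends only on α. -/
open MeasureTheory Set
open scoped ENNReal

lemma exists_two_le_and_eight_mul_rpow_eq {α : ℝ} (hα0 : 0 < α) (hα1 : α < 1) :
    ∃ s : ℝ, 2 ≤ s ∧ 8 * s ^ α = s := by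
  have h1 : 0 < 1 - α := by linarith
  have hpos : (0 : ℝ) < 8 ^ (1 / (1 - α)) := by positivity
  refine ⟨8 ^ (1 / (1 - α)), ?_, ?_⟩
  · have h : (8 : ℝ) ^ (1 : ℝ) ≤ 8 ^ (1 / (1 - α)) := by
      apply Real.rpow_le_rpow_of_exponent_le (by norm_num)
      rw [le_div_iff₀ h1]
      linarith
    rw [Real.rpow_one] at h
    linarith
  · have h8 : ((8 : ℝ) ^ (1 / (1 - α))) ^ (1 - α) = 8 := by
      rw [← Real.rpow_mul (by norm_num), one_div_mul_cancel h1.ne', Real.rpow_one]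
    nth_rewrite 1 [← h8]
    rw [← Real.rpow_add hpos, sub_add_cancel, Real.rpow_one]

lemma ofReal_div_ofReal_rpow {x : ℝ} (hx : 0 < x) (a α : ℝ) :
    ENNReal.ofReal a / ENNReal.ofReal (x ^ α) = ENNReal.ofReal (a * x ^ (-α)) := by
  rw [← ENNReal.ofReal_div_of_pos (by positivity), Real.rpow_neg hx.le, div_eq_mul_inv]

lemma lintegral_sq_div_rpow_ne_top {α : ℝ} (hα0 : 0 < α) (hα1 : α < 1) {u : ℝ → ℝ} {M C : ℝ}
    (hM : ∀ x : ℝ, 0 ≤ x → |u x| ≤ M) (hC : ∀ x : ℝ, 1 ≤ x → |u x| ≤ C * x ^ (-2 : ℝ)) :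
    ∫⁻ x in Ioi (0:ℝ), ENNReal.ofReal ((u x) ^ 2) / ENNReal.ofReal (x ^ α) ≠ ∞ := by
  rw [← Ioc_union_Ioi_eq_Ioi (zero_le_one (α := ℝ))]
  refine ((lintegral_union_le _ _ _).trans_lt (ENNReal.add_lt_top.2 ⟨?_, ?_⟩)).ne
  · have hint : IntegrableOn (fun x : ℝ => M ^ 2 * x ^ (-α)) (Ioc 0 1) := by
      apply Integrable.const_mul
      exact (intervalIntegrable_iff_integrableOn_Ioc_of_le zero_le_one).1
        (intervalIntegral.intervalIntegrable_rpow' (by linarith))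
    refine lt_of_le_of_lt (setLIntegral_mono' measurableSet_Ioc fun x hx => ?_)
      hint.lintegral_lt_top
    rw [ofReal_div_ofReal_rpow hx.1]
    have h0 := hx.1
    have h := sq_le_sq' (by linarith [hM x hx.1.le, neg_abs_le (u x)])
      ((le_abs_self _).trans (hM x hx.1.le))
    gcongr
  · have hint : IntegrableOn (fun x : ℝ => C ^ 2 * x ^ (-4 : ℝ)) (Ioi 1) :=
      (integrableOn_Ioi_rpow_of_lt (by norm_num) one_pos).const_mul _
    refine lt_of_le_of_lt (setLIntegral_mono' measurableSet_Ioi fun x hx => ?_)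
      hint.lintegral_lt_top
    have hx1 : 1 < x := hx
    have hx0 : 0 < x := by linarith
    rw [ofReal_div_ofReal_rpow hx0]
    have h := sq_le_sq' (by linarith [hC x hx1.le, neg_abs_le (u x)])
      ((le_abs_self _).trans (hC x hx1.le))
    have h4 : (C * x ^ (-2 : ℝ)) ^ 2 = C ^ 2 * x ^ (-4 : ℝ) := by
      rw [mul_pow, ← Real.rpow_mul_natCast hx0.le]
      norm_num
    rw [h4] at h
    apply ENNReal.ofReal_le_ofReal
    exact (mul_le_of_le_one_right (sq_nonneg _)
      (Real.rpow_le_one_of_one_le_of_nonpos hx1.le (by linarith))).trans h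

/-- The cone `{(x, y) | 0 < x, (s - 1) x < y < s x}`. -/
def slopeCone (s : ℝ) : Set (ℝ × ℝ) := {p | 0 < p.1 ∧ (s - 1) * p.1 < p.2 ∧ p.2 < s * p.1}

lemma measurableSet_slopeCone (s : ℝ) : MeasurableSet (slopeCone s) := by
  refine (measurableSet_lt measurable_const measurable_fst).inter ?_
  exact (measurableSet_lt (measurable_fst.const_mul _) measurable_snd).inter
    (measurableSet_lt measurable_snd (measurable_fst.const_mul _))

lemma lintegral_slopeCone_left {s x α : ℝ} (hs : 2 ≤ s) (hx : 0 < x) (a : ℝ) (ha : 0 ≤ a) :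
    ∫⁻ y in Ioi (0:ℝ), (slopeCone s).indicator
        (fun _ => ENNReal.ofReal (a * x ^ (-1 - α))) (x, y) =
      ENNReal.ofReal (a * x ^ (-α)) := by
  have hI : ∀ y, (slopeCone s).indicator (fun _ => ENNReal.ofReal (a * x ^ (-1 - α))) (x, y) =
      (Ioo ((s - 1) * x) (s * x)).indicator
        (fun _ => ENNReal.ofReal (a * x ^ (-1 - α))) y := by
    intro y
    simp [indicator, slopeCone, hx]
  simp_rw [hI]
  rw [lintegral_indicator_const measurableSet_Ioo, Measure.restrict_apply measurableSet_Ioo,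
    inter_eq_self_of_subset_left, Real.volume_Ioo, ← ENNReal.ofReal_mul (by positivity)]
  · congr 1
    have : x ^ (-α) = x ^ (-1 - α) * x := by
      rw [← Real.rpow_add_one hx.ne']
      congr 1
      ring
    rw [this]
    ring
  · intro y hy
    have : 0 < (s - 1) * x := mul_pos (by linarith) hx
    exact this.trans hy.1

lemma lintegral_slopeCone_right_le {s y α : ℝ} (hα0 : 0 < α) (hs : 2 ≤ s) (hsα : 8 * s ^ α = s)
    (hy : 0 < y) (a : ℝ) (ha : 0 ≤ a) :
    ∫⁻ x in Ioi (0:ℝ), (slopeCone s).indicator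
        (fun p => ENNReal.ofReal (2 * a * p.1 ^ (-1 - α))) (x, y) ≤
      2⁻¹ * ENNReal.ofReal (a * y ^ (-α)) := by
  have hs0 : 0 < s := by linarith
  have hs1 : 0 < s - 1 := by linarith
  have hle : ∀ x, (slopeCone s).indicator
        (fun p => ENNReal.ofReal (2 * a * p.1 ^ (-1 - α))) (x, y) ≤
      (Ioo (y / s) (y / (s - 1))).indicator
        (fun _ => ENNReal.ofReal (2 * a * (y / s) ^ (-1 - α))) x := by
    intro x
    by_cases h : (x, y) ∈ slopeCone s
    · obtain ⟨hx, h1, h2⟩ := id h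
      simp only at hx h1 h2
      have hxs : y / s < x := by rw [div_lt_iff₀ hs0]; linarith
      have hmem : x ∈ Ioo (y / s) (y / (s - 1)) :=
        ⟨hxs, by rw [lt_div_iff₀ hs1]; linarith⟩
      rw [indicator_of_mem h, indicator_of_mem hmem]
      apply ENNReal.ofReal_le_ofReal
      exact mul_le_mul_of_nonneg_left
        (Real.rpow_le_rpow_of_nonpos (by positivity) hxs.le (by linarith)) (by positivity)
    · rw [indicator_of_notMem h]
      exact zero_le
  calc _ ≤ ∫⁻ x, (Ioo (y / s) (y / (s - 1))).indicator
        (fun _ => ENNReal.ofReal (2 * a * (y / s) ^ (-1 - α))) x :=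
        (lintegral_mono hle).trans (setLIntegral_le_lintegral _ _)
    _ ≤ ENNReal.ofReal (2⁻¹ * (a * y ^ (-α))) := by
      rw [lintegral_indicator_const measurableSet_Ioo, Real.volume_Ioo,
        ← ENNReal.ofReal_mul (by positivity)]
      apply ENNReal.ofReal_le_ofReal
      have e1 : (y / s) ^ (-1 - α) = y ^ (-α) / y * (s ^ α * s) := by
        rw [Real.div_rpow hy.le hs0.le, show -1 - α = -α - 1 by ring, Real.rpow_sub_one hy.ne',
          Real.rpow_sub_one hs0.ne', Real.rpow_neg hs0.le]
        field_simp
      have e2 : s ^ α = s / 8 := by linarith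
      rw [e1, e2]
      have e3 : 2 * a * (y ^ (-α) / y * (s / 8 * s)) * (y / (s - 1) - y / s) =
          a * y ^ (-α) * (s / (4 * (s - 1))) := by
        field_simp
        ring
      rw [e3, mul_comm 2⁻¹]
      have : s / (4 * (s - 1)) ≤ 2⁻¹ := by
        rw [div_le_iff₀ (by positivity)]
        linarith
      gcongr
    _ = _ := by
      rw [ENNReal.ofReal_mul (by norm_num), ENNReal.ofReal_inv_of_pos (by norm_num),
        ENNReal.ofReal_ofNat]

lemma indicator_slopeCone_le {s α : ℝ} (hα0 : 0 < α) (hs : 2 ≤ s) (u : ℝ → ℝ) (x y : ℝ) :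
    (slopeCone s).indicator (fun _ => ENNReal.ofReal ((u x) ^ 2 * x ^ (-1 - α))) (x, y) ≤
      (slopeCone s).indicator
        (fun p => ENNReal.ofReal (2 * (u y) ^ 2 * p.1 ^ (-1 - α))) (x, y) +
      ENNReal.ofReal (2 * s ^ (1 + α)) *
        (ENNReal.ofReal ((u x - u y) ^ 2) / ENNReal.ofReal (|x - y| ^ (1 + α))) := by
  by_cases h : (x, y) ∈ slopeCone s
  · obtain ⟨hx, h1, h2⟩ := id h
    simp only at hx h1 h2
    rw [indicator_of_mem h, indicator_of_mem h]
    have hxy : x < y := by nlinarith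
    have hd : 0 < |x - y| := abs_pos.2 (by linarith)
    have hd' : |x - y| ≤ s * x := by rw [abs_sub_comm, abs_of_pos (by linarith)]; linarith
    have hs0 : 0 < s := by linarith
    rw [ofReal_div_ofReal_rpow hd, ← ENNReal.ofReal_mul (by positivity),
      ← ENNReal.ofReal_add (by positivity) (by positivity)]
    apply ENNReal.ofReal_le_ofReal
    have hk : x ^ (-1 - α) ≤ s ^ (1 + α) * |x - y| ^ (-(1 + α)) := by
      have hp : (s * x) ^ (-(1 + α)) ≤ |x - y| ^ (-(1 + α)) :=
        Real.rpow_le_rpow_of_nonpos hd hd' (by linarith)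
      have he : x ^ (-1 - α) = s ^ (1 + α) * (s * x) ^ (-(1 + α)) := by
        rw [Real.mul_rpow hs0.le hx.le, ← mul_assoc, ← Real.rpow_add hs0, add_neg_cancel,
          Real.rpow_zero, one_mul]
        congr 1
        ring
      rw [he]
      gcongr
    have hk0 : 0 ≤ x ^ (-1 - α) := by positivity
    calc u x ^ 2 * x ^ (-1 - α)
        ≤ (2 * u y ^ 2 + 2 * (u x - u y) ^ 2) * x ^ (-1 - α) := by
          gcongr
          nlinarith [sq_nonneg (u x - 2 * u y)]
      _ = 2 * u y ^ 2 * x ^ (-1 - α) + 2 * (u x - u y) ^ 2 * x ^ (-1 - α) := by ring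
      _ ≤ 2 * u y ^ 2 * x ^ (-1 - α) +
          2 * (u x - u y) ^ 2 * (s ^ (1 + α) * |x - y| ^ (-(1 + α))) := by gcongr
      _ = _ := by ring
  · rw [indicator_of_notMem h]
    exact zero_le

lemma lintegral_sq_div_rpow_le {s α : ℝ} (hα0 : 0 < α) (hs : 2 ≤ s) (hsα : 8 * s ^ α = s)
    {u : ℝ → ℝ} (hu : Measurable u) :
    ∫⁻ x in Ioi (0:ℝ), ENNReal.ofReal ((u x) ^ 2) / ENNReal.ofReal (x ^ α) ≤
      2⁻¹ * (∫⁻ x in Ioi (0:ℝ), ENNReal.ofReal ((u x) ^ 2) / ENNReal.ofReal (x ^ α)) +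
      ENNReal.ofReal (2 * s ^ (1 + α)) *
        ∫⁻ x in Ioi (0:ℝ), ∫⁻ y in Ioi (0:ℝ),
          ENNReal.ofReal ((u x - u y) ^ 2) / ENNReal.ofReal (|x - y| ^ (1 + α)) := by
  have hmeas : Measurable (fun p : ℝ × ℝ => (slopeCone s).indicator
      (fun q => ENNReal.ofReal (2 * (u p.2) ^ 2 * q.1 ^ (-1 - α))) p) :=
    Measurable.indicator (f := fun p : ℝ × ℝ =>
      ENNReal.ofReal (2 * (u p.2) ^ 2 * p.1 ^ (-1 - α))) (by fun_prop) (measurableSet_slopeCone s)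
  have hswap := lintegral_lintegral_swap (μ := volume.restrict (Ioi (0 : ℝ)))
    (ν := volume.restrict (Ioi (0 : ℝ))) (f := fun x y => (slopeCone s).indicator
      (fun q => ENNReal.ofReal (2 * (u y) ^ 2 * q.1 ^ (-1 - α))) (x, y)) hmeas.aemeasurable
  calc ∫⁻ x in Ioi (0:ℝ), ENNReal.ofReal ((u x) ^ 2) / ENNReal.ofReal (x ^ α)
      = ∫⁻ x in Ioi (0:ℝ), ∫⁻ y in Ioi (0:ℝ), (slopeCone s).indicator
          (fun _ => ENNReal.ofReal ((u x) ^ 2 * x ^ (-1 - α))) (x, y) := by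
        refine setLIntegral_congr_fun measurableSet_Ioi fun x hx => ?_
        rw [lintegral_slopeCone_left hs hx _ (sq_nonneg _), ofReal_div_ofReal_rpow hx]
    _ ≤ ∫⁻ x in Ioi (0:ℝ), ((∫⁻ y in Ioi (0:ℝ), (slopeCone s).indicator
            (fun p => ENNReal.ofReal (2 * (u y) ^ 2 * p.1 ^ (-1 - α))) (x, y)) +
          ENNReal.ofReal (2 * s ^ (1 + α)) * ∫⁻ y in Ioi (0:ℝ),
            (ENNReal.ofReal ((u x - u y) ^ 2) / ENNReal.ofReal (|x - y| ^ (1 + α)))) := by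
        refine lintegral_mono fun x => ?_
        refine (lintegral_mono fun y => indicator_slopeCone_le hα0 hs u x y).trans_eq ?_
        have hx : Measurable fun y => (slopeCone s).indicator
            (fun p => ENNReal.ofReal (2 * (u y) ^ 2 * p.1 ^ (-1 - α))) (x, y) :=
          hmeas.comp measurable_prodMk_left
        rw [lintegral_add_left hx,
          lintegral_const_mul' _ _ ENNReal.ofReal_ne_top]
    _ = (∫⁻ y in Ioi (0:ℝ), ∫⁻ x in Ioi (0:ℝ), (slopeCone s).indicator
            (fun p => ENNReal.ofReal (2 * (u y) ^ 2 * p.1 ^ (-1 - α))) (x, y)) +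
        ENNReal.ofReal (2 * s ^ (1 + α)) * ∫⁻ x in Ioi (0:ℝ), ∫⁻ y in Ioi (0:ℝ),
            (ENNReal.ofReal ((u x - u y) ^ 2) / ENNReal.ofReal (|x - y| ^ (1 + α))) := by
        rw [lintegral_add_left hmeas.lintegral_prod_right',
          lintegral_const_mul' _ _ ENNReal.ofReal_ne_top, hswap]
    _ ≤ _ := by
        gcongr
        rw [← lintegral_const_mul' _ _ (by simp)]
        refine setLIntegral_mono' measurableSet_Ioi fun y hy => ?_
        rw [ofReal_div_ofReal_rpow hy]
        exact lintegral_slopeCone_right_le hα0 hs hsα hy _ (sq_nonneg _)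

/-- fractional Hardy inequality on the half-line: if u is bounded on [0,∞)
and |u(x)| ≤ C x^{-2} for x ≥ 1, then
∫₀^∞∫₀^∞ (u(x)-u(y))²/|x-y|^{1+α} dx dy ≥ c ∫₀^∞ u(x)²/x^α dx with c = c(α) > 0. -/
theorem stmt_4 (α : ℝ) (hα0 : 0 < α) (hα1 : α < 1) :
    ∃ c : ℝ, 0 < c ∧ ∀ u : ℝ → ℝ, Measurable u →
      (∃ M : ℝ, ∀ x : ℝ, 0 ≤ x → |u x| ≤ M) →
      (∃ C : ℝ, 0 < C ∧ ∀ x : ℝ, 1 ≤ x → |u x| ≤ C * x ^ (-2 : ℝ)) →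
      ENNReal.ofReal c *
          ∫⁻ x in Ioi (0:ℝ), ENNReal.ofReal ((u x) ^ 2) / ENNReal.ofReal (x ^ α) ≤
        ∫⁻ x in Ioi (0:ℝ), ∫⁻ y in Ioi (0:ℝ),
          ENNReal.ofReal ((u x - u y) ^ 2) / ENNReal.ofReal (|x - y| ^ (1 + α)) := by
  obtain ⟨s, hs, hsα⟩ := exists_two_le_and_eight_mul_rpow_eq hα0 hα1
  have hs0 : 0 < s := by linarith
  refine ⟨(4 * s ^ (1 + α))⁻¹, by positivity, ?_⟩
  rintro u hu ⟨M, hM⟩ ⟨C, -, hC⟩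
  have hfin := lintegral_sq_div_rpow_ne_top hα0 hα1 hM hC
  have hle := lintegral_sq_div_rpow_le hα0 hs hsα hu
  generalize (∫⁻ x in Ioi (0:ℝ), ENNReal.ofReal ((u x) ^ 2) / ENNReal.ofReal (x ^ α)) = A
    at hfin hle ⊢
  generalize (∫⁻ x in Ioi (0:ℝ), ∫⁻ y in Ioi (0:ℝ),
    ENNReal.ofReal ((u x - u y) ^ 2) / ENNReal.ofReal (|x - y| ^ (1 + α))) = E at hle ⊢
  rcases eq_or_ne E ∞ with hE | hE
  · rw [hE]
    exact le_top
  have hK : (0 : ℝ) < s ^ (1 + α) := by positivity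
  lift A to NNReal using hfin
  lift E to NNReal using hE
  have hreal : (A : ℝ) ≤ 2⁻¹ * A + 2 * s ^ (1 + α) * E := by
    have h := ENNReal.toReal_mono (by finiteness) hle
    rw [ENNReal.toReal_add (by finiteness) (by finiteness)] at h
    simpa [ENNReal.toReal_mul, ENNReal.toReal_ofReal, hK.le] using h
  rw [← ENNReal.ofReal_coe_nnreal, ← ENNReal.ofReal_coe_nnreal,
    ← ENNReal.ofReal_mul (by positivity)]
  apply ENNReal.ofReal_le_ofReal
  rw [inv_mul_le_iff₀ (by positivity)]
  linarith
end

section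
/- Let 0 < α < 1 and let u be a bounded measurable function on [0,1] with ∫₀¹ u(x) dx = 0. Then ∫₀¹∫₀¹ (u(x)-u(y))²/|x-y|^{1+α} dx dy ≥ c ∫₀¹ u(x)²/min{x^α, (1-x)^α} dx, where c > 0 depends only on α. -/
open MeasureTheory Set
open scoped ENNReal

/-- The Gagliardo energy `∫₀¹∫₀¹ (u(x)-u(y))²/|x-y|^{1+α} dy dx`. -/
noncomputable def gagliardoEnergy (α : ℝ) (u : ℝ → ℝ) : ℝ≥0∞ :=
  ∫⁻ x in Icc (0:ℝ) 1, ∫⁻ y in Icc (0:ℝ) 1,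
    ENNReal.ofReal ((u x - u y) ^ 2) / ENNReal.ofReal (|x - y| ^ (1 + α))

lemma ae_mem_Ioo_restrict_Icc (a b : ℝ) : ∀ᵐ x ∂(volume.restrict (Icc a b)), x ∈ Ioo a b := by
  rw [← restrict_Ioo_eq_restrict_Icc]
  exact ae_restrict_mem measurableSet_Ioo

/-- Poincaré inequality for the Gagliardo energy. -/
lemma lintegral_sq_le_gagliardoEnergy {α : ℝ} (hα : 0 < α) {u : ℝ → ℝ} (hu : Measurable u)
    {M : ℝ} (hM : ∀ x ∈ Icc (0:ℝ) 1, |u x| ≤ M) (h0 : (∫ x in Icc (0:ℝ) 1, u x) = 0) :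
    ∫⁻ x in Icc (0:ℝ) 1, ENNReal.ofReal (u x ^ 2) ≤ gagliardoEnergy α u := by
  have hint : IntegrableOn u (Icc (0:ℝ) 1) := by
    refine Measure.integrableOn_of_bounded (M := M) (by simp) hu.aestronglyMeasurable ?_
    filter_upwards [ae_restrict_mem measurableSet_Icc] with x hx using hM x hx
  have hint2 : IntegrableOn (fun x => u x ^ 2) (Icc (0:ℝ) 1) := by
    refine Measure.integrableOn_of_bounded (M := M ^ 2) (by simp)
      (hu.pow_const 2).aestronglyMeasurable ?_
    filter_upwards [ae_restrict_mem measurableSet_Icc] with x hx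
    rw [Real.norm_eq_abs, abs_pow]
    exact pow_le_pow_left₀ (abs_nonneg _) (hM x hx) 2
  refine setLIntegral_mono' measurableSet_Icc fun x hx => ?_
  have hexp : ∀ y, (u x - u y) ^ 2 = u x ^ 2 - 2 * u x * u y + u y ^ 2 := fun y => by ring
  have hc : IntegrableOn (fun _ : ℝ => u x ^ 2) (Icc (0:ℝ) 1) := by simp
  have hc2 : IntegrableOn (fun y : ℝ => 2 * u x * u y) (Icc (0:ℝ) 1) := hint.const_mul _
  have hI : IntegrableOn (fun y => (u x - u y) ^ 2) (Icc (0:ℝ) 1) := by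
    simp only [hexp]
    exact (hc.sub hc2).add hint2
  have hval : u x ^ 2 ≤ ∫ y in Icc (0:ℝ) 1, (u x - u y) ^ 2 := by
    simp only [hexp]
    have hsplit : ∫ y in Icc (0:ℝ) 1, (u x ^ 2 - 2 * u x * u y + u y ^ 2) =
        (∫ y in Icc (0:ℝ) 1, (u x ^ 2 - 2 * u x * u y)) + ∫ y in Icc (0:ℝ) 1, u y ^ 2 :=
      integral_add (hc.sub hc2) hint2
    rw [hsplit, integral_sub hc hc2, integral_const_mul, h0]
    have : 0 ≤ ∫ y in Icc (0:ℝ) 1, u y ^ 2 := integral_nonneg fun y => sq_nonneg _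
    simpa using this
  calc ENNReal.ofReal (u x ^ 2)
      ≤ ENNReal.ofReal (∫ y in Icc (0:ℝ) 1, (u x - u y) ^ 2) := ENNReal.ofReal_le_ofReal hval
    _ = ∫⁻ y in Icc (0:ℝ) 1, ENNReal.ofReal ((u x - u y) ^ 2) :=
        ofReal_integral_eq_lintegral_ofReal hI (ae_of_all _ fun y => sq_nonneg _)
    _ ≤ _ := by
        refine setLIntegral_mono' measurableSet_Icc fun y hy => ?_
        have hle : |x - y| ^ (1 + α) ≤ 1 := by
          refine Real.rpow_le_one (abs_nonneg _) ?_ (by linarith)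
          rw [abs_le]
          constructor <;> linarith [hx.1, hx.2, hy.1, hy.2]
        calc ENNReal.ofReal ((u x - u y) ^ 2)
            = ENNReal.ofReal ((u x - u y) ^ 2) / 1 := by simp
          _ ≤ _ := ENNReal.div_le_div_left (by simpa using ENNReal.ofReal_le_ofReal hle) _

lemma measurePreserving_one_sub_restrict_Icc :
    MeasurePreserving (fun x : ℝ => 1 - x) (volume.restrict (Icc (0:ℝ) 1))
      (volume.restrict (Icc (0:ℝ) 1)) := by
  have h := (Measure.measurePreserving_sub_left (volume : Measure ℝ) 1).restrict_preimage
    (measurableSet_Icc (a := (0:ℝ)) (b := 1))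
  simpa using h

lemma lintegral_one_sub (f : ℝ → ℝ≥0∞) :
    ∫⁻ x in Icc (0:ℝ) 1, f (1 - x) = ∫⁻ x in Icc (0:ℝ) 1, f x :=
  measurePreserving_one_sub_restrict_Icc.lintegral_comp_emb
    (MeasurableEquiv.subLeft (1:ℝ)).measurableEmbedding f

lemma gagliardoEnergy_one_sub (α : ℝ) (u : ℝ → ℝ) :
    gagliardoEnergy α (fun x => u (1 - x)) = gagliardoEnergy α u := by
  unfold gagliardoEnergy
  rw [← lintegral_one_sub]
  refine lintegral_congr fun x => ?_
  rw [← lintegral_one_sub]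
  refine lintegral_congr fun y => ?_
  simp only [sub_sub_cancel]
  rw [show 1 - x - (1 - y) = y - x by ring, abs_sub_comm]

lemma lintegral_sq_mul_rpow_lt_top {α : ℝ} (hα1 : α < 1) {u : ℝ → ℝ}
    {M : ℝ} (hM : ∀ x ∈ Icc (0:ℝ) 1, |u x| ≤ M) :
    ∫⁻ x in Icc (0:ℝ) 1, ENNReal.ofReal (u x ^ 2 * x ^ (-α)) < ∞ := by
  have hi : IntegrableOn (fun x : ℝ => M ^ 2 * x ^ (-α)) (Icc 0 1) := by
    have := intervalIntegral.intervalIntegrable_rpow' (a := 0) (b := 1) (r := -α) (by linarith)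
    rw [intervalIntegrable_iff_integrableOn_Icc_of_le zero_le_one] at this
    exact this.const_mul _
  refine lt_of_le_of_lt ?_ hi.lintegral_lt_top
  refine setLIntegral_mono' measurableSet_Icc fun x hx => ENNReal.ofReal_le_ofReal ?_
  refine mul_le_mul_of_nonneg_right ?_ (Real.rpow_nonneg hx.1 _)
  rw [← sq_abs]
  exact pow_le_pow_left₀ (abs_nonneg _) (hM x hx) 2

/-- The pointwise comparison of `u x` with `u y` on the cone `L x ≤ y ≤ 2 L x`. -/
lemma sq_mul_rpow_le_of_mem_cone {α L x y : ℝ} (hα : 0 < α) (hL : 1 < L) (hx : 0 < x)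
    (h1 : L * x ≤ y) (h2 : y ≤ 2 * L * x) (a b : ℝ) :
    ENNReal.ofReal (a ^ 2 * x ^ (-(1 + α)) / L) ≤
      ENNReal.ofReal (2 * (2 * L) ^ (1 + α) / L * (b ^ 2 * y ^ (-(1 + α)))) +
      ENNReal.ofReal (2 * (2 * L) ^ (1 + α) / L) *
        (ENNReal.ofReal ((a - b) ^ 2) / ENNReal.ofReal (|x - y| ^ (1 + α))) := by
  have hL0 : 0 < L := by linarith
  have hxy : x < y := by nlinarith
  have hy : 0 < y := hx.trans hxy
  have hd : 0 < |x - y| := abs_pos.2 (by linarith)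
  have hdle : |x - y| ≤ 2 * L * x := by
    rw [abs_sub_comm, abs_of_pos (by linarith)]; linarith
  have key : ∀ z : ℝ, 0 < z → z ≤ 2 * L * x →
      x ^ (-(1 + α)) ≤ (2 * L) ^ (1 + α) * z ^ (-(1 + α)) := by
    intro z hz hzx
    have hz' : z ^ (1 + α) ≤ (2 * L) ^ (1 + α) * x ^ (1 + α) := by
      rw [← Real.mul_rpow (by positivity) hx.le]
      exact Real.rpow_le_rpow hz.le hzx (by linarith)
    rw [Real.rpow_neg hx.le, Real.rpow_neg hz.le, ← div_eq_mul_inv, le_div_iff₀ (by positivity),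
      inv_mul_le_iff₀ (by positivity)]
    linarith
  rw [← ENNReal.ofReal_div_of_pos (by positivity), ← ENNReal.ofReal_mul (by positivity),
    ← ENNReal.ofReal_add (by positivity) (by positivity)]
  refine ENNReal.ofReal_le_ofReal ?_
  have hk1 := key y hy h2
  have hk2 := key _ hd hdle
  have hab : a ^ 2 ≤ 2 * b ^ 2 + 2 * (a - b) ^ 2 := by nlinarith [sq_nonneg (a - 2 * b)]
  rw [Real.rpow_neg hd.le] at hk2
  calc a ^ 2 * x ^ (-(1 + α)) / L
      ≤ (2 * b ^ 2 + 2 * (a - b) ^ 2) * x ^ (-(1 + α)) / L := by gcongr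
    _ = (2 * b ^ 2 * x ^ (-(1 + α)) + 2 * (a - b) ^ 2 * x ^ (-(1 + α))) / L := by ring
    _ ≤ (2 * b ^ 2 * ((2 * L) ^ (1 + α) * y ^ (-(1 + α))) +
          2 * (a - b) ^ 2 * ((2 * L) ^ (1 + α) * (|x - y| ^ (1 + α))⁻¹)) / L := by gcongr
    _ = _ := by ring

/-- Hardy inequality at the left endpoint, with an `L²` remainder. -/
lemma exists_lintegral_sq_mul_rpow_le {α : ℝ} (hα0 : 0 < α) (hα1 : α < 1) :
    ∃ C : ℝ, 0 < C ∧ ∀ u : ℝ → ℝ, Measurable u → ∀ M : ℝ, (∀ x ∈ Icc (0:ℝ) 1, |u x| ≤ M) →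
      ∫⁻ x in Icc (0:ℝ) 1, ENNReal.ofReal (u x ^ 2 * x ^ (-α)) ≤
        ENNReal.ofReal C *
          ((∫⁻ x in Icc (0:ℝ) 1, ENNReal.ofReal (u x ^ 2)) + gagliardoEnergy α u) := by
  obtain ⟨L, hL, hLα⟩ : ∃ L : ℝ, 1 < L ∧ L ^ (α - 1) = 1 / 8 := by
    refine ⟨8 ^ (1 - α)⁻¹, Real.one_lt_rpow (by norm_num) (inv_pos.2 (by linarith)), ?_⟩
    rw [← Real.rpow_mul (by norm_num),
      show (1 - α)⁻¹ * (α - 1) = -1 by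
        have : 1 - α ≠ 0 := by linarith
        field_simp; ring, Real.rpow_neg_one]
    norm_num
  have hL0 : 0 < L := by linarith
  set B : ℝ := 2 * (2 * L) ^ (1 + α) / L with hB
  have hB0 : 0 < B := by positivity
  set A : ℝ := (1 / (2 * L)) ^ (-α)
  have hA0 : 0 < A := by positivity
  have hBL : B / (2 * L) ≤ 1 / 2 := by
    have h2 : (2:ℝ) ^ α ≤ 2 := by
      simpa using Real.rpow_le_rpow_of_exponent_le (x := 2) (by norm_num) hα1.le
    have : B / (2 * L) = 2 * (2 ^ α * L ^ (α - 1)) := by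
      rw [hB, Real.rpow_add (by positivity), Real.rpow_one, Real.mul_rpow (by norm_num) hL0.le,
        Real.rpow_sub hL0, Real.rpow_one]
      field_simp
    rw [this, hLα]
    linarith
  refine ⟨2 * (A + B), by positivity, fun u hu M hM => ?_⟩
  set J := ∫⁻ x in Icc (0:ℝ) 1, ENNReal.ofReal (u x ^ 2 * x ^ (-α)) with hJ
  set P := ∫⁻ x in Icc (0:ℝ) 1, ENNReal.ofReal (u x ^ 2)
  have hJfin : J < ∞ := lintegral_sq_mul_rpow_lt_top hα1 hM
  let S : Set (ℝ × ℝ) := {p | L * p.1 ≤ p.2 ∧ p.2 ≤ 2 * L * p.1}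
  have hS : MeasurableSet S :=
    (measurableSet_le (f := fun p : ℝ × ℝ => L * p.1) (g := fun p => p.2)
      (by fun_prop) (by fun_prop)).inter
    (measurableSet_le (f := fun p : ℝ × ℝ => p.2) (g := fun p => 2 * L * p.1)
      (by fun_prop) (by fun_prop))
  let F : ℝ × ℝ → ℝ≥0∞ :=
    S.indicator fun p => ENNReal.ofReal (B * (u p.2 ^ 2 * p.2 ^ (-(1 + α))))
  have hF : Measurable F := by
    refine Measurable.indicator ?_ hS
    fun_prop
  have hpt : ∀ᵐ x ∂(volume.restrict (Icc (0:ℝ) 1)), ENNReal.ofReal (u x ^ 2 * x ^ (-α)) ≤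
      ENNReal.ofReal A * ENNReal.ofReal (u x ^ 2) + ((∫⁻ y in Icc (0:ℝ) 1, F (x, y)) +
        ENNReal.ofReal B * ∫⁻ y in Icc (0:ℝ) 1,
          ENNReal.ofReal ((u x - u y) ^ 2) / ENNReal.ofReal (|x - y| ^ (1 + α))) := by
    filter_upwards [ae_mem_Ioo_restrict_Icc 0 1] with x hx
    have hx0 : 0 < x := hx.1
    rcases le_total (1 / (2 * L)) x with hxa | hxa
    · refine le_trans ?_ le_self_add
      rw [← ENNReal.ofReal_mul hA0.le, mul_comm]
      refine ENNReal.ofReal_le_ofReal (mul_le_mul_of_nonneg_right ?_ (sq_nonneg _))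
      exact Real.rpow_le_rpow_of_nonpos (by positivity) hxa (by linarith)
    · refine le_trans ?_ le_add_self
      have hx1 : 2 * L * x ≤ 1 := by
        rw [le_div_iff₀ (by positivity)] at hxa; linarith
      have hsub : Icc (L * x) (2 * L * x) ⊆ Icc 0 1 :=
        Icc_subset_Icc (by positivity) hx1
      calc ENNReal.ofReal (u x ^ 2 * x ^ (-α))
          = ∫⁻ y in Icc (L * x) (2 * L * x),
              ENNReal.ofReal (u x ^ 2 * x ^ (-(1 + α)) / L) := by
            rw [setLIntegral_const, Real.volume_Icc, ← ENNReal.ofReal_mul (by positivity)]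
            congr 1
            rw [show -α = -(1 + α) + 1 by ring, Real.rpow_add hx0, Real.rpow_one]
            field_simp
            ring
        _ ≤ ∫⁻ y in Icc (L * x) (2 * L * x), (F (x, y) + ENNReal.ofReal B *
              (ENNReal.ofReal ((u x - u y) ^ 2) / ENNReal.ofReal (|x - y| ^ (1 + α)))) := by
            refine setLIntegral_mono' measurableSet_Icc fun y hy => ?_
            have hmem : (x, y) ∈ S := hy
            simp only [F, indicator_of_mem hmem]
            exact sq_mul_rpow_le_of_mem_cone hα0 hL hx0 hy.1 hy.2 _ _
        _ ≤ ∫⁻ y in Icc (0:ℝ) 1, (F (x, y) + ENNReal.ofReal B *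
              (ENNReal.ofReal ((u x - u y) ^ 2) / ENNReal.ofReal (|x - y| ^ (1 + α)))) :=
            lintegral_mono_set hsub
        _ = _ := by
            rw [lintegral_add_left (f := fun y => F (x, y)) (hF.comp measurable_prodMk_left),
              lintegral_const_mul' _ _ ENNReal.ofReal_ne_top]
  have hFJ : ∫⁻ x in Icc (0:ℝ) 1, ∫⁻ y in Icc (0:ℝ) 1, F (x, y) ≤ ENNReal.ofReal (1 / 2) * J := by
    rw [lintegral_lintegral_swap (f := fun x y => F (x, y)) hF.aemeasurable, hJ,
      ← lintegral_const_mul' _ _ ENNReal.ofReal_ne_top]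
    refine lintegral_mono_ae ?_
    filter_upwards [ae_mem_Ioo_restrict_Icc 0 1] with y hy
    have hy0 : 0 < y := hy.1
    calc ∫⁻ x in Icc (0:ℝ) 1, F (x, y)
        ≤ ∫⁻ x, F (x, y) := setLIntegral_le_lintegral _ _
      _ ≤ ∫⁻ x, (Icc (y / (2 * L)) (y / L)).indicator
            (fun _ => ENNReal.ofReal (B * (u y ^ 2 * y ^ (-(1 + α))))) x := by
          refine lintegral_mono fun x => ?_
          by_cases h : (x, y) ∈ S
          · have hx : x ∈ Icc (y / (2 * L)) (y / L) := by
              refine ⟨?_, ?_⟩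
              · rw [div_le_iff₀ (by positivity)]; linarith [h.2]
              · rw [le_div_iff₀ hL0]; linarith [h.1]
            simp only [F, indicator_of_mem h, indicator_of_mem hx, le_refl]
          · simp only [F, indicator_of_notMem h, zero_le]
      _ = ENNReal.ofReal (B * (u y ^ 2 * y ^ (-(1 + α)))) *
            ENNReal.ofReal (y / L - y / (2 * L)) := by
          rw [lintegral_indicator_const measurableSet_Icc, Real.volume_Icc]
      _ = ENNReal.ofReal (B / (2 * L) * (u y ^ 2 * y ^ (-α))) := by
          rw [← ENNReal.ofReal_mul (by positivity)]
          congr 1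
          rw [show -α = -(1 + α) + 1 by ring, Real.rpow_add hy0, Real.rpow_one]
          field_simp
          ring
      _ ≤ _ := by
          rw [← ENNReal.ofReal_mul (by norm_num)]
          exact ENNReal.ofReal_le_ofReal (mul_le_mul_of_nonneg_right hBL (by positivity))
  have hmain : J ≤ ENNReal.ofReal A * P + (ENNReal.ofReal (1 / 2) * J +
      ENNReal.ofReal B * gagliardoEnergy α u) := by
    calc J ≤ _ := lintegral_mono_ae hpt
      _ = ENNReal.ofReal A * P + ((∫⁻ x in Icc (0:ℝ) 1, ∫⁻ y in Icc (0:ℝ) 1, F (x, y)) +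
            ENNReal.ofReal B * gagliardoEnergy α u) := by
          rw [lintegral_add_left (by fun_prop), lintegral_add_left hF.lintegral_prod_right',
            lintegral_const_mul' _ _ ENNReal.ofReal_ne_top,
            lintegral_const_mul' _ _ ENNReal.ofReal_ne_top, gagliardoEnergy]
      _ ≤ _ := by gcongr
  generalize gagliardoEnergy α u = E at hmain ⊢
  rcases eq_or_ne (P + E) ∞ with htop | htop
  · rw [htop, ENNReal.mul_top (by simp; positivity)]
    exact le_top
  · obtain ⟨hPt, hEt⟩ := ENNReal.add_ne_top.1 htop
    clear_value J P
    lift J to NNReal using hJfin.ne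
    lift P to NNReal using hPt
    lift E to NNReal using hEt
    rw [← ENNReal.ofReal_coe_nnreal, ← ENNReal.ofReal_coe_nnreal, ← ENNReal.ofReal_coe_nnreal,
      ← ENNReal.ofReal_mul hA0.le, ← ENNReal.ofReal_mul hB0.le,
      ← ENNReal.ofReal_mul (by norm_num), ← ENNReal.ofReal_add (by positivity) (by positivity),
      ← ENNReal.ofReal_add (by positivity) (by positivity),
      ENNReal.ofReal_le_ofReal_iff (by positivity)] at hmain
    rw [← ENNReal.ofReal_coe_nnreal, ← ENNReal.ofReal_coe_nnreal, ← ENNReal.ofReal_coe_nnreal,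
      ← ENNReal.ofReal_add (by positivity) (by positivity), ← ENNReal.ofReal_mul (by positivity)]
    refine ENNReal.ofReal_le_ofReal ?_
    nlinarith [mul_nonneg hA0.le E.2, mul_nonneg hB0.le P.2]

lemma ofReal_div_min_rpow_le {α x : ℝ} (hx : x ∈ Ioo (0:ℝ) 1) (a : ℝ) :
    ENNReal.ofReal a / ENNReal.ofReal (min (x ^ α) ((1 - x) ^ α)) ≤
      ENNReal.ofReal (a * x ^ (-α)) + ENNReal.ofReal (a * (1 - x) ^ (-α)) := by
  have hx0 : 0 < x := hx.1
  have hx1 : 0 < 1 - x := by linarith [hx.2]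
  rw [Real.rpow_neg hx0.le, Real.rpow_neg hx1.le, ← div_eq_mul_inv, ← div_eq_mul_inv,
    ENNReal.ofReal_div_of_pos (by positivity), ENNReal.ofReal_div_of_pos (by positivity)]
  rcases min_choice (x ^ α) ((1 - x) ^ α) with h | h <;> rw [h]
  · exact le_self_add
  · exact le_add_self

/-- fractional Hardy inequality on [0,1] for bounded mean-zero functions:
∫₀¹∫₀¹ (u(x)-u(y))²/|x-y|^{1+α} dx dy ≥ c ∫₀¹ u(x)²/min{x^α,(1-x)^α} dx, c = c(α) > 0. -/
theorem stmt_6 (α : ℝ) (hα0 : 0 < α) (hα1 : α < 1) :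
    ∃ c : ℝ, 0 < c ∧ ∀ u : ℝ → ℝ, Measurable u →
      (∃ M : ℝ, ∀ x ∈ Icc (0:ℝ) 1, |u x| ≤ M) →
      (∫ x in Icc (0:ℝ) 1, u x) = 0 →
      ENNReal.ofReal c *
          ∫⁻ x in Icc (0:ℝ) 1,
            ENNReal.ofReal ((u x) ^ 2) / ENNReal.ofReal (min (x ^ α) ((1 - x) ^ α)) ≤
        ∫⁻ x in Icc (0:ℝ) 1, ∫⁻ y in Icc (0:ℝ) 1,
          ENNReal.ofReal ((u x - u y) ^ 2) / ENNReal.ofReal (|x - y| ^ (1 + α)) := by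
  obtain ⟨C, hC, hHardy⟩ := exists_lintegral_sq_mul_rpow_le hα0 hα1
  refine ⟨(4 * C)⁻¹, by positivity, fun u hu ⟨M, hM⟩ h0 => ?_⟩
  change _ ≤ gagliardoEnergy α u
  have hP := lintegral_sq_le_gagliardoEnergy hα0 hu hM h0
  have hleft := hHardy u hu M hM
  have hright := hHardy (fun x => u (1 - x)) (by fun_prop) M
    fun x hx => hM _ ⟨by linarith [hx.2], by linarith [hx.1]⟩
  rw [gagliardoEnergy_one_sub, lintegral_one_sub (fun x => ENNReal.ofReal (u x ^ 2)),
    ← lintegral_one_sub] at hright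
  simp only [sub_sub_cancel] at hright
  have hsum : ∫⁻ x in Icc (0:ℝ) 1,
      ENNReal.ofReal ((u x) ^ 2) / ENNReal.ofReal (min (x ^ α) ((1 - x) ^ α)) ≤
      ENNReal.ofReal (4 * C) * gagliardoEnergy α u := by
    calc _ ≤ ∫⁻ x in Icc (0:ℝ) 1, (ENNReal.ofReal (u x ^ 2 * x ^ (-α)) +
            ENNReal.ofReal (u x ^ 2 * (1 - x) ^ (-α))) := by
          refine lintegral_mono_ae ?_
          filter_upwards [ae_mem_Ioo_restrict_Icc 0 1] with x hx
          exact ofReal_div_min_rpow_le hx _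
      _ ≤ ENNReal.ofReal C * (gagliardoEnergy α u + gagliardoEnergy α u) +
            ENNReal.ofReal C * (gagliardoEnergy α u + gagliardoEnergy α u) := by
          rw [lintegral_add_left (by fun_prop)]
          refine add_le_add (hleft.trans ?_) (hright.trans ?_) <;> gcongr
      _ = _ := by
          rw [ENNReal.ofReal_mul (by norm_num), ENNReal.ofReal_ofNat]
          ring
  calc _ ≤ ENNReal.ofReal (4 * C)⁻¹ * (ENNReal.ofReal (4 * C) * gagliardoEnergy α u) := by
        gcongr
    _ = gagliardoEnergy α u := by
        rw [← mul_assoc, ← ENNReal.ofReal_mul (by positivity), inv_mul_cancel₀ (by positivity),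
          ENNReal.ofReal_one, one_mul]
end

section
/- Let 0 < α < 1. There exists a constant C > 0 and, for every integer n ≥ 2, a function uₙ ∈ C_c^∞((0,1)) with uₙ(x) = 1 for 1/n ≤ x ≤ 1-1/n, uₙ(x) = 0 for x ≤ 1/(2n) and for 1-1/(2n) ≤ x ≤ 1, 0 ≤ uₙ ≤ 1, and |uₙ'| ≤ Cn, such that ∫₀¹ uₙ(x)²/(x^α (1-x)^α) dx ≥ 1/C while ∫₀¹∫₀¹ (uₙ(x)-uₙ(y))²/|x-y|^{1+α} dx dy ≤ C n^{-(1-α)}. In particular, the fractional Hardy inequality ∫₀¹∫₀¹ (u(x)-u(y))²/|x-y|^{1+α} dx dy ≳ ∫₀¹ u(x)²/(x^α(1-x)^α) dx fails for u ∈ C_c^∞((0,1)). -/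
open MeasureTheory Set
open scoped ENNReal

/-- The kernel dominating the difference quotient of a `K`-Lipschitz function with values in
`[0, 1]`. -/
noncomputable def truncatedKernel (α K t : ℝ) : ℝ≥0∞ :=
  ENNReal.ofReal (min 1 ((K * t) ^ 2)) / ENNReal.ofReal (|t| ^ (1 + α))

lemma measurable_truncatedKernel (α K : ℝ) : Measurable (truncatedKernel α K) := by
  unfold truncatedKernel
  fun_prop

lemma truncatedKernel_neg (α K t : ℝ) : truncatedKernel α K (-t) = truncatedKernel α K t := by
  simp [truncatedKernel]

lemma setLIntegral_truncatedKernel_Ioc_le {α K : ℝ} (hα : α < 1) (hK : 0 < K) :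
    ∫⁻ t in Ioc 0 (1 / K), truncatedKernel α K t ≤ ENNReal.ofReal (K ^ α / (2 - α)) := by
  have hint : IntegrableOn (fun t : ℝ => K ^ 2 * t ^ (1 - α)) (Ioc 0 (1 / K)) := by
    rw [← intervalIntegrable_iff_integrableOn_Ioc_of_le (by positivity)]
    exact (intervalIntegral.intervalIntegrable_rpow' (by linarith)).const_mul _
  have hval : ∫ t in Ioc 0 (1 / K), K ^ 2 * t ^ (1 - α) = K ^ α / (2 - α) := by
    rw [← intervalIntegral.integral_of_le (by positivity), intervalIntegral.integral_const_mul,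
      integral_rpow (Or.inl (by linarith)), Real.zero_rpow (by linarith),
      show 1 - α + 1 = 2 - α by ring, one_div, Real.inv_rpow hK.le, ← Real.rpow_neg hK.le,
      sub_zero, mul_div_assoc', ← Real.rpow_natCast K 2, ← Real.rpow_add hK]
    congr 2
    push_cast
    ring
  rw [← hval, ofReal_integral_eq_lintegral_ofReal hint]
  · refine setLIntegral_mono' measurableSet_Ioc fun t ht => ?_
    have ht0 : 0 < t := ht.1
    rw [truncatedKernel, ← ENNReal.ofReal_div_of_pos (by positivity), abs_of_pos ht0]
    refine ENNReal.ofReal_le_ofReal ?_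
    rw [div_le_iff₀ (by positivity), mul_assoc, ← Real.rpow_add ht0,
      show 1 - α + (1 + α) = ((2 : ℕ) : ℝ) by push_cast; ring, Real.rpow_natCast, ← mul_pow]
    exact min_le_right _ _
  · filter_upwards [ae_restrict_mem measurableSet_Ioc] with t ht
    have ht0 : 0 < t := ht.1
    simp only [Pi.zero_apply]
    positivity

lemma setLIntegral_truncatedKernel_Ioi_le {α K : ℝ} (hα : 0 < α) (hK : 0 < K) :
    ∫⁻ t in Ioi (1 / K), truncatedKernel α K t ≤ ENNReal.ofReal (K ^ α / α) := by
  have hK' : 0 < 1 / K := by positivity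
  have hint : IntegrableOn (fun t : ℝ => t ^ (-(1 + α))) (Ioi (1 / K)) :=
    integrableOn_Ioi_rpow_of_lt (by linarith) hK'
  have hval : ∫ t in Ioi (1 / K), t ^ (-(1 + α)) = K ^ α / α := by
    rw [integral_Ioi_rpow_of_lt (by linarith) hK', show -(1 + α) + 1 = -α by ring, one_div,
      Real.inv_rpow hK.le, ← Real.rpow_neg hK.le, neg_neg, neg_div_neg_eq]
  rw [← hval, ofReal_integral_eq_lintegral_ofReal hint]
  · refine setLIntegral_mono' measurableSet_Ioi fun t ht => ?_
    have ht0 : 0 < t := hK'.trans ht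
    rw [truncatedKernel, ← ENNReal.ofReal_div_of_pos (by positivity), abs_of_pos ht0]
    refine ENNReal.ofReal_le_ofReal ?_
    rw [Real.rpow_neg ht0.le, ← one_div]
    gcongr
    exact min_le_left _ _
  · filter_upwards [ae_restrict_mem measurableSet_Ioi] with t ht
    have ht0 : 0 < t := hK'.trans ht
    simp only [Pi.zero_apply]
    positivity

lemma lintegral_truncatedKernel_le {α K : ℝ} (hα0 : 0 < α) (hα1 : α < 1) (hK : 0 < K) :
    ∫⁻ t, truncatedKernel α K t ≤ ENNReal.ofReal (2 * (1 / (2 - α) + 1 / α) * K ^ α) := by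
  have h2α : 0 < 2 - α := by linarith
  have hpos : ∫⁻ t in Ioi 0, truncatedKernel α K t ≤
      ENNReal.ofReal ((1 / (2 - α) + 1 / α) * K ^ α) := by
    rw [← Ioc_union_Ioi_eq_Ioi (show (0 : ℝ) ≤ 1 / K by positivity)]
    calc _ ≤ _ := lintegral_union_le _ _ _
      _ ≤ ENNReal.ofReal (K ^ α / (2 - α)) + ENNReal.ofReal (K ^ α / α) :=
        add_le_add (setLIntegral_truncatedKernel_Ioc_le hα1 hK)
          (setLIntegral_truncatedKernel_Ioi_le hα0 hK)
      _ = _ := by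
        rw [← ENNReal.ofReal_add (by positivity) (by positivity)]
        congr 1
        ring
  have hneg : ∫⁻ t in Iic 0, truncatedKernel α K t = ∫⁻ t in Ioi 0, truncatedKernel α K t := by
    rw [setLIntegral_congr Iio_ae_eq_Iic.symm,
      ← (Measure.measurePreserving_neg (volume : Measure ℝ)).setLIntegral_comp_preimage_emb
        (MeasurableEquiv.neg ℝ).measurableEmbedding]
    simp [truncatedKernel_neg]
  rw [← lintegral_add_compl _ (measurableSet_Ioi (a := (0 : ℝ))), compl_Ioi, hneg]
  refine (add_le_add hpos hpos).trans_eq ?_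
  rw [← ENNReal.ofReal_add (by positivity) (by positivity)]
  congr 1
  ring

lemma ofReal_sq_sub_div_le_truncatedKernel {u : ℝ → ℝ} {α K : ℝ}
    (hu : ∀ x, 0 ≤ u x ∧ u x ≤ 1) (hL : ∀ x y, |u x - u y| ≤ K * |x - y|) (x y : ℝ) :
    ENNReal.ofReal ((u x - u y) ^ 2) / ENNReal.ofReal (|x - y| ^ (1 + α)) ≤
      truncatedKernel α K (x - y) := by
  unfold truncatedKernel
  gcongr
  refine le_min ?_ ?_
  · have := hu x
    have := hu y
    exact (sq_le_one_iff_abs_le_one _).2 (abs_le.2 ⟨by linarith, by linarith⟩)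
  · rw [sq_le_sq, abs_mul]
    exact (hL x y).trans (by gcongr; exact le_abs_self K)

/-- The Gagliardo energy of a Lipschitz function that is constant off a set `A` is controlled by
the measure of `A`. -/
lemma lintegral_gagliardo_le {u : ℝ → ℝ} {α K c : ℝ} {S A : Set ℝ}
    (hu : ∀ x, 0 ≤ u x ∧ u x ≤ 1) (hL : ∀ x y, |u x - u y| ≤ K * |x - y|)
    (hS : MeasurableSet S) (hA : MeasurableSet A) (hc : ∀ x ∈ S, x ∉ A → u x = c) :
    (∫⁻ x in S, ∫⁻ y in S,
        ENNReal.ofReal ((u x - u y) ^ 2) / ENNReal.ofReal (|x - y| ^ (1 + α))) ≤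
      2 * (volume (A ∩ S) * ∫⁻ t, truncatedKernel α K t) := by
  have hk := measurable_truncatedKernel α K
  set G := ∫⁻ t, truncatedKernel α K t
  let f : ℝ → ℝ → ℝ≥0∞ := fun x y => A.indicator 1 x * truncatedKernel α K (x - y)
  have hind : Measurable (A.indicator (1 : ℝ → ℝ≥0∞)) := measurable_one.indicator hA
  have hf : Measurable (Function.uncurry f) := by
    unfold f Function.uncurry
    fun_prop
  have hf' : Measurable (Function.uncurry fun x y => f y x) := hf.comp measurable_swap
  have hint : ∫⁻ x in S, ∫⁻ y in S, f x y ≤ volume (A ∩ S) * G := by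
    calc _ ≤ ∫⁻ x in S, A.indicator 1 x * G := by
          refine lintegral_mono fun x => ?_
          unfold f
          rw [lintegral_const_mul _ (by fun_prop)]
          gcongr
          refine (setLIntegral_le_lintegral _ _).trans_eq ?_
          exact lintegral_sub_left_eq_self (truncatedKernel α K) x
      _ = _ := by
          rw [lintegral_mul_const _ hind, lintegral_indicator_one hA, Measure.restrict_apply hA]
  have hswap : ∫⁻ x in S, ∫⁻ y in S, f y x = ∫⁻ x in S, ∫⁻ y in S, f x y :=
    lintegral_lintegral_swap hf'.aemeasurable
  calc _ ≤ ∫⁻ x in S, ∫⁻ y in S, (f x y + f y x) := by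
        refine setLIntegral_mono' hS fun x hx => setLIntegral_mono' hS fun y hy => ?_
        have hxy := ofReal_sq_sub_div_le_truncatedKernel (α := α) hu hL x y
        by_cases hxA : x ∈ A
        · refine hxy.trans (le_add_right ?_)
          simp [f, hxA]
        by_cases hyA : y ∈ A
        · refine hxy.trans (le_add_left ?_)
          rw [← truncatedKernel_neg]
          simp [f, hyA]
        · simp [hc x hx hxA, hc y hy hyA]
    _ = (∫⁻ x in S, ∫⁻ y in S, f x y) + ∫⁻ x in S, ∫⁻ y in S, f y x := by
        rw [← lintegral_add_left hf.lintegral_prod_right]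
        refine lintegral_congr fun x => ?_
        exact lintegral_add_left (hf.comp measurable_prodMk_left) _
    _ ≤ _ := by
        rw [hswap, two_mul]
        gcongr

lemma exists_abs_deriv_smoothTransition_le :
    ∃ L : ℝ, 0 < L ∧ ∀ x, |deriv Real.smoothTransition x| ≤ L := by
  have hcont : Continuous (deriv Real.smoothTransition) :=
    (Real.smoothTransition.contDiff (n := 1)).continuous_deriv le_rfl
  obtain ⟨L, hL⟩ := (isCompact_Icc (a := (0 : ℝ)) (b := 1)).exists_bound_of_continuousOn
    hcont.continuousOn
  have hL0 : 0 ≤ L := (norm_nonneg _).trans (hL 0 (by simp))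
  refine ⟨L + 1, by linarith, fun x => ?_⟩
  have hzero : x ∉ Icc (0 : ℝ) 1 → deriv Real.smoothTransition x = 0 := fun hx => by
    rw [mem_Icc, not_and_or, not_le, not_le] at hx
    rcases hx with hx | hx
    · have : Real.smoothTransition =ᶠ[nhds x] fun _ => 0 := by
        filter_upwards [Iio_mem_nhds hx] with y hy
        exact Real.smoothTransition.zero_of_nonpos (le_of_lt hy)
      simp [this.deriv_eq]
    · have : Real.smoothTransition =ᶠ[nhds x] fun _ => 1 := by
        filter_upwards [Ioi_mem_nhds hx] with y hy
        exact Real.smoothTransition.one_of_one_le (le_of_lt hy)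
      simp [this.deriv_eq]
  by_cases hx : x ∈ Icc (0 : ℝ) 1
  · exact (hL x hx).trans (by linarith)
  · rw [hzero hx, abs_zero]
    linarith

/-- A smooth cutoff on `(0, 1)`, equal to `1` on `[1/r, 1 - 1/r]` and to `0` off
`[1/(2r), 1 - 1/(2r)]`. -/
noncomputable def intervalCutoff (r x : ℝ) : ℝ :=
  Real.smoothTransition (2 * r * x - 1) * Real.smoothTransition (2 * r * (1 - x) - 1)

namespace intervalCutoff

variable {r : ℝ}

lemma contDiff {n : ℕ∞} : ContDiff ℝ n (intervalCutoff r) :=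
  (Real.smoothTransition.contDiff.comp (by fun_prop)).mul
    (Real.smoothTransition.contDiff.comp (by fun_prop))

lemma mem_unit (x : ℝ) : 0 ≤ intervalCutoff r x ∧ intervalCutoff r x ≤ 1 :=
  ⟨mul_nonneg (Real.smoothTransition.nonneg _) (Real.smoothTransition.nonneg _),
    mul_le_one₀ (Real.smoothTransition.le_one _) (Real.smoothTransition.nonneg _)
      (Real.smoothTransition.le_one _)⟩

lemma eq_one (hr : 0 < r) {x : ℝ} (hx : x ∈ Icc (1 / r) (1 - 1 / r)) :
    intervalCutoff r x = 1 := by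
  have h1 : 1 ≤ x * r := (div_le_iff₀ hr).1 hx.1
  have h2 : 1 ≤ (1 - x) * r := (div_le_iff₀ hr).1 (by linarith [hx.2])
  rw [intervalCutoff, Real.smoothTransition.one_of_one_le (by linarith),
    Real.smoothTransition.one_of_one_le (by linarith), mul_one]

lemma eq_zero_of_le (hr : 0 < r) {x : ℝ} (hx : x ≤ 1 / (2 * r)) : intervalCutoff r x = 0 := by
  have h : x * (2 * r) ≤ 1 := (le_div_iff₀ (by positivity)).1 hx
  rw [intervalCutoff, Real.smoothTransition.zero_of_nonpos (by linarith), zero_mul]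

lemma eq_zero_of_ge (hr : 0 < r) {x : ℝ} (hx : 1 - 1 / (2 * r) ≤ x) :
    intervalCutoff r x = 0 := by
  have h : (1 - x) * (2 * r) ≤ 1 := (le_div_iff₀ (by positivity)).1 (by linarith)
  rw [intervalCutoff, Real.smoothTransition.zero_of_nonpos (x := 2 * r * (1 - x) - 1)
    (by linarith), mul_zero]

lemma tsupport_subset (hr : 0 < r) :
    tsupport (intervalCutoff r) ⊆ Icc (1 / (2 * r)) (1 - 1 / (2 * r)) := by
  refine closure_minimal (fun x hx => ?_) isClosed_Icc
  by_contra h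
  rw [mem_Icc, not_and_or, not_le, not_le] at h
  rcases h with h | h
  · exact hx (eq_zero_of_le hr h.le)
  · exact hx (eq_zero_of_ge hr h.le)

lemma abs_deriv_le (hr : 0 < r) {L : ℝ} (hL : ∀ x, |deriv Real.smoothTransition x| ≤ L) (x : ℝ) :
    |deriv (intervalCutoff r) x| ≤ 4 * L * r := by
  have hs (t : ℝ) : HasDerivAt Real.smoothTransition (deriv Real.smoothTransition t) t :=
    ((Real.smoothTransition.contDiff (n := 1)).differentiable (by simp) t).hasDerivAt
  have h1 : HasDerivAt (fun x : ℝ => 2 * r * x - 1) (2 * r) x := by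
    simpa using ((hasDerivAt_id x).const_mul (2 * r)).sub_const 1
  have h2 : HasDerivAt (fun x : ℝ => 2 * r * (1 - x) - 1) (-(2 * r)) x := by
    simpa using (((hasDerivAt_id x).const_sub 1).const_mul (2 * r)).sub_const 1
  have h := ((hs _).comp x h1).mul ((hs _).comp x h2)
  have hd : deriv (intervalCutoff r) x = _ := h.deriv
  rw [hd]
  have habs (s t : ℝ) : |deriv Real.smoothTransition s * (2 * r) * Real.smoothTransition t| ≤
      L * (2 * r) * 1 := by
    rw [abs_mul, abs_mul, abs_of_pos (show 0 < 2 * r by positivity),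
      abs_of_nonneg (Real.smoothTransition.nonneg t)]
    have hL0 : 0 ≤ L := (abs_nonneg _).trans (hL 0)
    gcongr
    · exact Real.smoothTransition.nonneg t
    · exact hL s
    · exact Real.smoothTransition.le_one t
  refine (abs_add_le _ _).trans ?_
  have ha := habs (2 * r * x - 1) (2 * r * (1 - x) - 1)
  have hb := habs (2 * r * (1 - x) - 1) (2 * r * x - 1)
  simp only [Function.comp_apply, mul_neg, abs_neg]
  rw [mul_comm (Real.smoothTransition (2 * r * x - 1))]
  linarith

lemma abs_sub_le (hr : 0 < r) {L : ℝ} (hL : ∀ x, |deriv Real.smoothTransition x| ≤ L)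
    (x y : ℝ) : |intervalCutoff r x - intervalCutoff r y| ≤ 4 * L * r * |x - y| :=
  Convex.norm_image_sub_le_of_norm_deriv_le (s := univ)
    (fun z _ => (contDiff (n := 1)).differentiable (by simp) z)
    (fun z _ => abs_deriv_le hr hL z) convex_univ (mem_univ y) (mem_univ x)

lemma le_of_mem_Ioo (hr : 2 ≤ r) {x : ℝ} (hx : x ∈ Ioo (3 / 8 : ℝ) (5 / 8)) :
    Real.smoothTransition (1 / 2) ^ 2 ≤ intervalCutoff r x := by
  rw [sq]
  have h0 := Real.smoothTransition.nonneg (1 / 2)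
  exact mul_le_mul (Real.smoothTransition.monotone (by nlinarith [hx.1]))
    (Real.smoothTransition.monotone (by nlinarith [hx.2])) h0 (Real.smoothTransition.nonneg _)

lemma le_lintegral_weighted {α : ℝ} (hα : 0 ≤ α) (hr : 2 ≤ r) :
    ENNReal.ofReal (Real.smoothTransition (1 / 2) ^ 4 / 4) ≤
      ∫⁻ x in Ioo (0 : ℝ) 1,
        ENNReal.ofReal (intervalCutoff r x ^ 2 / (x ^ α * (1 - x) ^ α)) := by
  have hsub : Ioo (3 / 8 : ℝ) (5 / 8) ⊆ Ioo 0 1 := Ioo_subset_Ioo (by norm_num) (by norm_num)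
  calc _ = ∫⁻ _ in Ioo (3 / 8 : ℝ) (5 / 8),
        ENNReal.ofReal (Real.smoothTransition (1 / 2) ^ 4) := by
        rw [setLIntegral_const, Real.volume_Ioo, ← ENNReal.ofReal_mul (by positivity)]
        norm_num [div_eq_mul_inv]
    _ ≤ ∫⁻ x in Ioo (3 / 8 : ℝ) (5 / 8),
        ENNReal.ofReal (intervalCutoff r x ^ 2 / (x ^ α * (1 - x) ^ α)) := by
        refine setLIntegral_mono' measurableSet_Ioo fun x hx => ENNReal.ofReal_le_ofReal ?_
        obtain ⟨hx0, hx1⟩ := hsub hx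
        have hx1' : 0 < 1 - x := by linarith
        have hw : x ^ α * (1 - x) ^ α ≤ 1 :=
          mul_le_one₀ (Real.rpow_le_one hx0.le hx1.le hα) (by positivity)
            (Real.rpow_le_one hx1'.le (by linarith) hα)
        have hle : Real.smoothTransition (1 / 2) ^ 4 ≤ intervalCutoff r x ^ 2 := by
          rw [show Real.smoothTransition (1 / 2) ^ 4 = (Real.smoothTransition (1 / 2) ^ 2) ^ 2 by
            ring]
          gcongr
          exact le_of_mem_Ioo hr hx
        exact hle.trans (le_div_self (sq_nonneg _) (by positivity) hw)
    _ ≤ _ := lintegral_mono_set hsub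

lemma lintegral_gagliardo_le {α L : ℝ} (hα0 : 0 < α) (hα1 : α < 1) (hr : 2 ≤ r) (hL0 : 0 < L)
    (hL : ∀ x, |deriv Real.smoothTransition x| ≤ L) :
    (∫⁻ x in Ioo (0 : ℝ) 1, ∫⁻ y in Ioo (0 : ℝ) 1,
        ENNReal.ofReal ((intervalCutoff r x - intervalCutoff r y) ^ 2) /
          ENNReal.ofReal (|x - y| ^ (1 + α))) ≤
      ENNReal.ofReal (8 * (1 / (2 - α) + 1 / α) * (4 * L) ^ α * r ^ (-(1 - α))) := by
  have hr0 : 0 < r := by linarith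
  have h2α : 0 < 2 - α := by linarith
  have hvol : volume ((Icc (1 / r) (1 - 1 / r))ᶜ ∩ Ioo (0 : ℝ) 1) ≤ ENNReal.ofReal (2 / r) := by
    have hsub : (Icc (1 / r) (1 - 1 / r))ᶜ ∩ Ioo (0 : ℝ) 1 ⊆
        Ioo 0 (1 / r) ∪ Ioo (1 - 1 / r) 1 := by
      rintro x ⟨hx, hx0, hx1⟩
      rw [mem_compl_iff, mem_Icc, not_and_or, not_le, not_le] at hx
      exact hx.imp (fun h => ⟨hx0, h⟩) fun h => ⟨h, hx1⟩
    refine (measure_mono hsub).trans ((measure_union_le _ _).trans_eq ?_)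
    rw [Real.volume_Ioo, Real.volume_Ioo, ← ENNReal.ofReal_add (by simp [hr0.le])
      (by simp [hr0.le])]
    congr 1
    ring
  refine (_root_.lintegral_gagliardo_le mem_unit (abs_sub_le hr0 hL) measurableSet_Ioo
    measurableSet_Icc.compl fun x _ hx => eq_one hr0 (not_notMem.1 hx)).trans ?_
  calc _ ≤ 2 * (ENNReal.ofReal (2 / r) *
        ENNReal.ofReal (2 * (1 / (2 - α) + 1 / α) * (4 * L * r) ^ α)) := by
        gcongr
        exact lintegral_truncatedKernel_le hα0 hα1 (by positivity)
    _ = _ := by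
        rw [← ENNReal.ofReal_mul (by positivity), ← ENNReal.ofReal_ofNat 2,
          ← ENNReal.ofReal_mul (by norm_num), Real.mul_rpow (by positivity) hr0.le, neg_sub,
          Real.rpow_sub_one hr0.ne']
        congr 1
        ring

end intervalCutoff

/-- counterexample functions uₙ ∈ C_c^∞((0,1)) showing that the fractional
Hardy inequality on (0,1) fails for compactly supported smooth functions. -/
theorem stmt_9 (α : ℝ) (hα0 : 0 < α) (hα1 : α < 1) :
    (∃ C : ℝ, 0 < C ∧ ∀ n : ℕ, 2 ≤ n → ∃ u : ℝ → ℝ,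
      ContDiff ℝ (⊤ : ℕ∞) u ∧ HasCompactSupport u ∧ tsupport u ⊆ Ioo 0 1 ∧
      (∀ x ∈ Icc (1 / (n:ℝ)) (1 - 1 / (n:ℝ)), u x = 1) ∧
      (∀ x : ℝ, x ≤ 1 / (2 * (n:ℝ)) → u x = 0) ∧
      (∀ x : ℝ, 1 - 1 / (2 * (n:ℝ)) ≤ x → u x = 0) ∧
      (∀ x : ℝ, 0 ≤ u x ∧ u x ≤ 1) ∧
      (∀ x : ℝ, |deriv u x| ≤ C * (n:ℝ)) ∧
      ENNReal.ofReal (1 / C) ≤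
        (∫⁻ x in Ioo (0:ℝ) 1, ENNReal.ofReal ((u x) ^ 2 / (x ^ α * (1 - x) ^ α))) ∧
      (∫⁻ x in Ioo (0:ℝ) 1, ∫⁻ y in Ioo (0:ℝ) 1,
          ENNReal.ofReal ((u x - u y) ^ 2) / ENNReal.ofReal (|x - y| ^ (1 + α)))
        ≤ ENNReal.ofReal (C * (n:ℝ) ^ (-(1 - α)))) ∧
    ¬ (∃ c : ℝ, 0 < c ∧ ∀ u : ℝ → ℝ,
        ContDiff ℝ (⊤ : ℕ∞) u → HasCompactSupport u → tsupport u ⊆ Ioo 0 1 →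
        ENNReal.ofReal c *
            (∫⁻ x in Ioo (0:ℝ) 1, ENNReal.ofReal ((u x) ^ 2 / (x ^ α * (1 - x) ^ α))) ≤
          ∫⁻ x in Ioo (0:ℝ) 1, ∫⁻ y in Ioo (0:ℝ) 1,
            ENNReal.ofReal ((u x - u y) ^ 2) / ENNReal.ofReal (|x - y| ^ (1 + α))) := by
  have key : ∃ C : ℝ, 0 < C ∧ ∀ n : ℕ, 2 ≤ n → ∃ u : ℝ → ℝ,
      ContDiff ℝ (⊤ : ℕ∞) u ∧ HasCompactSupport u ∧ tsupport u ⊆ Ioo 0 1 ∧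
      (∀ x ∈ Icc (1 / (n:ℝ)) (1 - 1 / (n:ℝ)), u x = 1) ∧
      (∀ x : ℝ, x ≤ 1 / (2 * (n:ℝ)) → u x = 0) ∧
      (∀ x : ℝ, 1 - 1 / (2 * (n:ℝ)) ≤ x → u x = 0) ∧
      (∀ x : ℝ, 0 ≤ u x ∧ u x ≤ 1) ∧
      (∀ x : ℝ, |deriv u x| ≤ C * (n:ℝ)) ∧
      ENNReal.ofReal (1 / C) ≤
        (∫⁻ x in Ioo (0:ℝ) 1, ENNReal.ofReal ((u x) ^ 2 / (x ^ α * (1 - x) ^ α))) ∧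
      (∫⁻ x in Ioo (0:ℝ) 1, ∫⁻ y in Ioo (0:ℝ) 1,
          ENNReal.ofReal ((u x - u y) ^ 2) / ENNReal.ofReal (|x - y| ^ (1 + α)))
        ≤ ENNReal.ofReal (C * (n:ℝ) ^ (-(1 - α))) := by
    obtain ⟨L, hL0, hL⟩ := exists_abs_deriv_smoothTransition_le
    have h2α : 0 < 2 - α := by linarith
    have ha : 0 < Real.smoothTransition (1 / 2) ^ 4 / 4 := by
      have := Real.smoothTransition.pos_of_pos (x := 1 / 2) (by norm_num)
      positivity
    set a := Real.smoothTransition (1 / 2) ^ 4 / 4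
    set B := 8 * (1 / (2 - α) + 1 / α) * (4 * L) ^ α
    have hB : 0 < B := by positivity
    have ha' : 0 < 1 / a := by positivity
    refine ⟨4 * L + B + 1 / a, by positivity, fun n hn => ?_⟩
    have hn2 : (2 : ℝ) ≤ n := by exact_mod_cast hn
    have hn0 : (0 : ℝ) < n := by linarith
    have hinv : 0 < 1 / (2 * (n : ℝ)) := by positivity
    refine ⟨intervalCutoff n, intervalCutoff.contDiff,
      isCompact_Icc.of_isClosed_subset (isClosed_tsupport _) (intervalCutoff.tsupport_subset hn0),
      (intervalCutoff.tsupport_subset hn0).trans (Icc_subset_Ioo hinv (by linarith)),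
      fun x hx => intervalCutoff.eq_one hn0 hx, fun x hx => intervalCutoff.eq_zero_of_le hn0 hx,
      fun x hx => intervalCutoff.eq_zero_of_ge hn0 hx, intervalCutoff.mem_unit,
      fun x => (intervalCutoff.abs_deriv_le hn0 hL x).trans ?_,
      le_trans (ENNReal.ofReal_le_ofReal ?_) (intervalCutoff.le_lintegral_weighted hα0.le hn2),
      (intervalCutoff.lintegral_gagliardo_le hα0 hα1 hn2 hL0 hL).trans
        (ENNReal.ofReal_le_ofReal ?_)⟩
    · gcongr
      linarith
    · rw [one_div_le (by positivity) ha]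
      linarith
    · change B * _ ≤ _
      gcongr
      linarith
  refine ⟨key, ?_⟩
  rintro ⟨c, hc, hardy⟩
  obtain ⟨C, hC, hkey⟩ := key
  have hbound (n : ℕ) (hn : 2 ≤ n) : c * (1 / C) ≤ C * (n : ℝ) ^ (-(1 - α)) := by
    obtain ⟨u, hu, hcpt, hsupp, -, -, -, -, -, hlow, hup⟩ := hkey n hn
    have h := (mul_le_mul_right hlow (ENNReal.ofReal c)).trans
      ((hardy u hu hcpt hsupp).trans hup)
    rwa [← ENNReal.ofReal_mul hc.le, ENNReal.ofReal_le_ofReal_iff (by positivity)] at h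
  have hlim : Filter.Tendsto (fun n : ℕ => C * (n : ℝ) ^ (-(1 - α))) Filter.atTop (nhds 0) := by
    simpa using ((tendsto_rpow_neg_atTop (by linarith : 0 < 1 - α)).comp
      tendsto_natCast_atTop_atTop).const_mul C
  have hle : c * (1 / C) ≤ 0 := ge_of_tendsto hlim (by
    filter_upwards [Filter.eventually_ge_atTop 2] with n hn using hbound n hn)
  have : 0 < c * (1 / C) := by positivity
  linarith
end

section
/- Let φ ∈ C_c^∞(ℝ) be a smooth compactly supported function with φ(x) = x for all x in some neighborhood of the origin. Then |φ| ∉ H^{3/2}(ℝ); equivalently, ∫∫_{ℝ×ℝ} |g(x)-g(y)|²/|x-y|² dx dy = ∞ where g is the (weak) derivative of |φ|, which equals sgn(φ(x))·φ'(x). -/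
open MeasureTheory Set
open scoped ENNReal

/-- A Lipschitz function on the line may be integrated by parts against a compactly supported
Lipschitz function. -/
theorem LipschitzWith.integral_mul_deriv_eq_neg_deriv_mul {C D : NNReal} {f g : ℝ → ℝ}
    (hf : LipschitzWith C f) (hg : LipschitzWith D g) (hgs : HasCompactSupport g) :
    ∫ x, f x * deriv g x = - ∫ x, deriv f x * g x := by
  have h := hf.integral_lineDeriv_mul_eq (μ := volume) hg hgs 1
  have key : ∀ (u : ℝ → ℝ) (x : ℝ), lineDeriv ℝ u x 1 = deriv u x := by
    intro u x
    have : deriv (fun t => u (x + t)) 0 = deriv u (x + 0) := deriv_comp_const_add u x 0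
    simpa [lineDeriv] using this
  simp only [lineDeriv_neg, key] at h
  rw [h, ← integral_neg]
  congr 1 with x
  ring

/-- At zeros of `f` both sides vanish, since `|f|` has a local minimum there. -/
theorem deriv_abs_eq_sign_mul_deriv {f : ℝ → ℝ} {x : ℝ} (hf : DifferentiableAt ℝ f x) :
    deriv (fun y => |f y|) x = Real.sign (f x) * deriv f x := by
  rcases lt_trichotomy (f x) 0 with h | h | h
  · have : (fun y => |f y|) =ᶠ[nhds x] fun y => -f y := by
      filter_upwards [hf.continuousAt.eventually_lt_const h] with y hy using abs_of_neg hy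
    rw [this.deriv_eq, Real.sign_of_neg h, deriv.fun_neg]
    ring
  · have : IsLocalMin (fun y => |f y|) x := by
      filter_upwards with y
      simp [h]
    rw [this.deriv_eq_zero, h, Real.sign_zero, zero_mul]
  · have : (fun y => |f y|) =ᶠ[nhds x] f := by
      filter_upwards [hf.continuousAt.eventually_const_lt h] with y hy using abs_of_pos hy
    rw [this.deriv_eq, Real.sign_of_pos h, one_mul]

theorem lintegral_ofReal_inv_Ioo_eq_top {ε : ℝ} (hε : 0 < ε) :
    ∫⁻ x in Ioo 0 ε, ENNReal.ofReal x⁻¹ = ⊤ := by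
  by_contra h
  have hint : IntegrableOn (fun x : ℝ => x⁻¹) (Ioo 0 ε) := by
    refine (lintegral_ofReal_ne_top_iff_integrable measurable_inv.aestronglyMeasurable ?_).1 h
    filter_upwards [ae_restrict_mem measurableSet_Ioo] with x hx using inv_nonneg.2 hx.1.le
  have := (intervalIntegrable_iff_integrableOn_Ioo_of_le hε.le).2 hint
  rw [intervalIntegrable_inv_iff] at this
  simp [hε.ne, hε.le] at this

/-- A function equal to `-1` on the left and `1` on the right of the origin has infinite
Gagliardo seminorm of order `1/2`. -/
theorem lintegral_gagliardo_eq_top_of_jump {g : ℝ → ℝ} {ε : ℝ} (hε : 0 < ε)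
    (hpos : ∀ x ∈ Ioo 0 ε, g x = 1) (hneg : ∀ x ∈ Ioo (-ε) 0, g x = -1) :
    ∫⁻ x, ∫⁻ y, ENNReal.ofReal ((g x - g y) ^ 2) / ENNReal.ofReal (|x - y| ^ 2) = ⊤ := by
  rw [← top_le_iff, ← lintegral_ofReal_inv_Ioo_eq_top hε]
  refine le_trans (setLIntegral_mono_ae' measurableSet_Ioo (Filter.Eventually.of_forall ?_))
    (setLIntegral_le_lintegral (Ioo 0 ε) _)
  intro x hx
  have hx0 : 0 < x := hx.1
  calc ENNReal.ofReal x⁻¹ = ∫⁻ _ in Ioo (-x) 0, ENNReal.ofReal (x⁻¹ ^ 2) := by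
        rw [setLIntegral_const, Real.volume_Ioo, ← ENNReal.ofReal_mul (by positivity)]
        congr 1
        field_simp
        ring
    _ ≤ ∫⁻ y in Ioo (-x) 0,
          ENNReal.ofReal ((g x - g y) ^ 2) / ENNReal.ofReal (|x - y| ^ 2) := by
        refine setLIntegral_mono_ae' measurableSet_Ioo (Filter.Eventually.of_forall ?_)
        intro y hy
        have hxy : 0 < x - y := by linarith [hy.2]
        rw [hpos x hx, hneg y ⟨by linarith [hy.1, hx.2], hy.2⟩, sq_abs,
          ← ENNReal.ofReal_div_of_pos (by positivity)]
        apply ENNReal.ofReal_le_ofReal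
        rw [inv_pow, inv_eq_one_div, div_le_div_iff₀ (by positivity) (by positivity)]
        nlinarith [hy.1]
    _ ≤ _ := setLIntegral_le_lintegral _ _

/-- if φ ∈ C_c^∞(ℝ) with φ(x) = x near 0, then |φ| ∉ H^{3/2}(ℝ):
the weak derivative of |φ| is g(x) = sgn(φ(x))·φ'(x), and its Gagliardo seminorm of
order 1/2, ∫∫ |g(x)-g(y)|²/|x-y|² dx dy, is infinite. -/
theorem stmt_18 (φ : ℝ → ℝ) (h1 : ContDiff ℝ (⊤ : ℕ∞) φ) (h2 : HasCompactSupport φ)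
    (h3 : ∃ ε : ℝ, 0 < ε ∧ ∀ x : ℝ, |x| < ε → φ x = x) :
    (∀ ψ : ℝ → ℝ, ContDiff ℝ (⊤ : ℕ∞) ψ → HasCompactSupport ψ →
      ∫ x : ℝ, |φ x| * deriv ψ x = - ∫ x : ℝ, (Real.sign (φ x) * deriv φ x) * ψ x) ∧
    (∫⁻ x : ℝ, ∫⁻ y : ℝ,
        ENNReal.ofReal ((Real.sign (φ x) * deriv φ x - Real.sign (φ y) * deriv φ y) ^ 2) /
          ENNReal.ofReal (|x - y| ^ 2)) = ⊤ := by
  obtain ⟨ε, hε, hφ⟩ := h3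
  have hdiff : Differentiable ℝ φ := h1.differentiable (by simp)
  constructor
  · intro ψ hψ hψs
    obtain ⟨C, hC⟩ := (h1.of_le (by simp)).lipschitzWith_of_hasCompactSupport h2 one_ne_zero
    obtain ⟨D, hD⟩ := (hψ.of_le (by simp)).lipschitzWith_of_hasCompactSupport hψs one_ne_zero
    have habs : LipschitzWith (1 * C) fun x => |φ x| := lipschitzWith_one_norm.comp hC
    rw [habs.integral_mul_deriv_eq_neg_deriv_mul hD hψs]
    simp only [deriv_abs_eq_sign_mul_deriv (hdiff _)]
  · have hderiv : ∀ x, |x| < ε → deriv φ x = 1 := by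
      intro x hx
      have : φ =ᶠ[nhds x] id := by
        filter_upwards [continuous_abs.continuousAt.eventually_lt_const hx] with y hy using hφ y hy
      rw [this.deriv_eq, deriv_id]
    refine lintegral_gagliardo_eq_top_of_jump hε (fun x hx => ?_) (fun x hx => ?_)
    · have hx' : |x| < ε := abs_lt.2 ⟨by linarith [hx.1], hx.2⟩
      rw [hφ x hx', hderiv x hx', Real.sign_of_pos hx.1, one_mul]
    · have hx' : |x| < ε := abs_lt.2 ⟨hx.1, by linarith [hx.2]⟩
      rw [hφ x hx', hderiv x hx', Real.sign_of_neg hx.2, mul_one]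
end
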